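/- arXiv:math/9411239 — 2 statements merged into one kernel-verified Lean document; each statement's English description precedes it below -/
import Mathlib

section
/- For all natural numbers a, b, c, the number N(a,b,c) of plane partitions in an a×b×c box satisfies N(a,b,c) · H(a+b) · H(a+c) · H(b+c) = H(a+b+c) · H(a) · H(b) · H(c). -/
/-- A plane partition in an `a × b × c` box: a lower set of `Fin a × Fin b × Fin c`
for the componentwise order. -/
def IsPP (a b c : ℕ) (T : Finset (Fin a × Fin b × Fin c)) : Prop :=
  ∀ p ∈ T, ∀ q : Fin a × Fin b × Fin c,
    q.1 ≤ p.1 → q.2.1 ≤ p.2.1 → q.2.2 ≤ p.2.2 → q ∈ T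

set_option synthInstance.maxSize 400 in
instance (a b c : ℕ) : DecidablePred (IsPP a b c) := fun _ => by
  unfold IsPP; infer_instance

/-- The hyperfactorial `H(n) = ∏_{k=0}^{n-1} k!`. -/
def hyperfactorial (n : ℕ) : ℕ := ∏ k ∈ Finset.range n, Nat.factorial k

open Finset

theorem det_choose_succ {n : ℕ} (v : Fin (n + 1) → ℕ) :
    (Matrix.of fun i j : Fin (n + 1) => ((v i).choose j : ℤ)).det =
      (Matrix.of fun i j : Fin n =>
        ((v i.succ).choose (j + 1) : ℤ) - (v i.castSucc).choose (j + 1)).det := by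
  rw [Matrix.det_eq_of_forall_row_eq_smul_add_pred
    (B := Matrix.of fun i j : Fin (n + 1) => Fin.cases ((v 0).choose j : ℤ)
      (fun i => ((v i.succ).choose j : ℤ) - (v i.castSucc).choose j) i) (fun _ => 1)
    (by simp) (by simp), Matrix.det_succ_column_zero, Fin.sum_univ_succ]
  simp [Matrix.submatrix]

theorem prod_factorial_mul_det_choose {n : ℕ} (v : Fin n → ℕ) :
    (∏ j : Fin n, ((j : ℕ).factorial : ℤ)) *
        (Matrix.of fun i j : Fin n => ((v i).choose j : ℤ)).det =
      (Matrix.vandermonde fun i => (v i : ℤ)).det := by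
  rw [← Matrix.det_mul_row, Matrix.det_eval_matrixOfPolynomials_eq_det_vandermonde
    (fun i => (v i : ℤ)) (fun j => descPochhammer ℤ j)
    (fun j => descPochhammer_natDegree ℤ j) (fun j => monic_descPochhammer ℤ j)]
  congr 1
  ext i j
  simp [descPochhammer_eval_eq_descFactorial, Nat.descFactorial_eq_factorial_mul_choose]

theorem sum_Icc_choose_add {l u : ℕ} (h : l ≤ u) (i j : ℕ) :
    ∑ m ∈ Icc l u, ((m + i).choose j : ℤ) =
      ((u + i + 1).choose (j + 1) : ℤ) - (l + i).choose (j + 1) := by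
  induction u, h using Nat.le_induction with
  | base => simp [Nat.choose_succ_succ]
  | succ u h ih =>
    rw [← Finset.insert_Icc_right_eq_Icc_add_one (by omega), Finset.sum_insert (by simp), ih]
    rw [show u + 1 + i = u + i + 1 by ring, Nat.choose_succ_succ (u + i + 1) j]
    push_cast
    ring

/-- The sequences interlacing with `x`. -/
def interlacing {n : ℕ} (x : Fin (n + 1) → ℕ) : Finset (Fin n → ℕ) :=
  Fintype.piFinset fun i => Icc (x i.castSucc) (x i.succ)

theorem sum_interlacing_det_choose {n : ℕ} (x : Fin (n + 1) → ℕ) (hx : Monotone x) :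
    ∑ y ∈ interlacing x, (Matrix.of fun i j : Fin n => ((y i + i).choose j : ℤ)).det =
      (Matrix.of fun i j : Fin (n + 1) => ((x i + i).choose j : ℤ)).det := by
  rw [det_choose_succ fun i => x i + i]
  have key := (Matrix.detRowAlternating (n := Fin n) (R := ℤ)).toMultilinearMap.map_sum_finset
    (fun (i : Fin n) (m : ℕ) (j : Fin n) => ((m + i).choose j : ℤ))
    (fun i => Icc (x i.castSucc) (x i.succ))
  refine key.symm.trans (congrArg Matrix.det ?_)
  ext i j
  rw [Finset.sum_apply, sum_Icc_choose_add (hx i.castSucc_le_succ)]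
  simp [add_assoc]

open Classical in
/-- Gelfand–Tsetlin patterns with top row `x`, as functions vanishing outside `p + q < n`. -/
noncomputable def gtPatterns : (n : ℕ) → (Fin n → ℕ) → Finset (ℕ → ℕ → ℕ)
  | 0, _ => {0}
  | n + 1, x => (interlacing x).biUnion fun y => (gtPatterns n y).image fun T p q =>
      if h : p + q = n then x ⟨p, by omega⟩ else T p q

theorem mem_gtPatterns {n : ℕ} {x : Fin n → ℕ} {T : ℕ → ℕ → ℕ} :
    T ∈ gtPatterns n x ↔
      (∀ p q, n ≤ p + q → T p q = 0) ∧ (∀ p : Fin n, T p (n - 1 - p) = x p) ∧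
      (∀ p q, p + q + 1 < n → T p (q + 1) ≤ T p q ∧ T p q ≤ T (p + 1) q) := by
  induction n generalizing T with
  | zero =>
    simp only [gtPatterns, mem_singleton, funext_iff]
    simp
  | succ n ih =>
    simp only [gtPatterns, mem_biUnion, mem_image, ih, interlacing, Fintype.mem_piFinset, mem_Icc]
    constructor
    · rintro ⟨y, hy, T, ⟨h0, h1, h2⟩, rfl⟩
      refine ⟨fun p q h => ?_, fun p => ?_, fun p q h => ?_⟩
      · beta_reduce
        rw [dif_neg (by omega), h0 _ _ (by omega)]
      · beta_reduce
        rw [dif_pos (by omega)]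
      · beta_reduce
        rw [dif_neg (c := p + q = n) (by omega)]
        rcases Nat.lt_or_ge (p + q + 1) n with h' | h'
        · rw [dif_neg (by omega), dif_neg (by omega)]
          exact h2 p q h'
        · rw [dif_pos (by omega), dif_pos (by omega)]
          have e := h1 ⟨p, by omega⟩
          have e2 := hy ⟨p, by omega⟩
          simp only at e
          rw [show n - 1 - p = q by omega] at e
          rw [e]
          exact e2
    · rintro ⟨h0, h1, h2⟩
      refine ⟨fun p => T p (n - 1 - p), fun p => ?_,
        fun p q => if p + q < n then T p q else 0, ⟨?_, ?_, ?_⟩, ?_⟩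
      · have e1 := h1 p.castSucc
        have e2 := h1 p.succ
        have e3 := h2 p (n - 1 - p) (by omega)
        simp only [Fin.val_castSucc, Fin.val_succ] at e1 e2
        rw [show n - 1 - (p : ℕ) + 1 = n + 1 - 1 - p by omega] at e3
        rw [show n + 1 - 1 - ((p : ℕ) + 1) = n - 1 - p by omega] at e2
        rwa [e1, e2] at e3
      · intro p q h
        beta_reduce
        rw [if_neg (by omega)]
      · intro p
        beta_reduce
        rw [if_pos (by omega)]
      · intro p q h
        beta_reduce
        rw [if_pos (by omega), if_pos (by omega), if_pos (by omega)]
        exact h2 p q (by omega)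
      · ext p q
        beta_reduce
        split_ifs with h h'
        · rw [← h1 ⟨p, by omega⟩]
          simp only
          congr 1
          omega
        · rfl
        · rw [h0 p q (by omega)]

theorem card_gtPatterns {n : ℕ} (x : Fin n → ℕ) (hx : Monotone x) :
    ((gtPatterns n x).card : ℤ) =
      (Matrix.of fun i j : Fin n => ((x i + i).choose j : ℤ)).det := by
  classical
  induction n with
  | zero => simp [gtPatterns]
  | succ n ih =>
    rw [← sum_interlacing_det_choose x hx, gtPatterns, card_biUnion]
    · push_cast
      refine sum_congr rfl fun y hy => ?_
      rw [← ih y, card_image_of_injOn]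
      · intro T hT T' hT' h
        ext p q
        have e := congrFun₂ h p q
        simp only at e
        split_ifs at e with hpq
        · rw [(mem_gtPatterns.1 hT).1 p q (by omega), (mem_gtPatterns.1 hT').1 p q (by omega)]
        · exact e
      · simp only [interlacing, Fintype.mem_piFinset, mem_Icc] at hy
        intro i j hij
        rcases hij.eq_or_lt with rfl | hij
        · rfl
        · exact (hy i).2.trans ((hx (Fin.le_def.2 (by simpa using hij))).trans (hy j).1)
    · intro y _ y' _ hne
      rw [Function.onFun, disjoint_left]
      rintro S hS hS'
      obtain ⟨T, hT, rfl⟩ := mem_image.1 hS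
      obtain ⟨T', hT', h⟩ := mem_image.1 hS'
      apply hne
      ext p
      have e := congrFun₂ h p (n - 1 - p)
      rw [dif_neg (by omega), dif_neg (by omega), (mem_gtPatterns.1 hT).2.1,
        (mem_gtPatterns.1 hT').2.1] at e
      exact e.symm

theorem det_vandermonde_eq_prod_range (n : ℕ) (w : ℕ → ℤ) :
    (Matrix.vandermonde fun i : Fin n => w i).det =
      ∏ j ∈ range n, ∏ i ∈ range j, (w j - w i) := by
  rw [Matrix.det_vandermonde, Finset.prod_comm' (t' := univ) (s' := fun j => Iio j) (by simp),
    ← Fin.prod_univ_eq_prod_range]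
  refine prod_congr rfl fun j _ => ?_
  rw [← Nat.Iio_eq_range, ← Fin.map_valEmbedding_Iio, prod_map]
  rfl

theorem prod_range_cast_sub {n k : ℕ} (h : k ≤ n) :
    ∏ i ∈ range k, ((n : ℤ) - i) = n.descFactorial k := by
  rw [Nat.descFactorial_eq_prod_range, Nat.cast_prod]
  refine prod_congr rfl fun i hi => ?_
  rw [Nat.cast_sub ((mem_range.1 hi).le.trans h)]

theorem hyperfactorial_add (m n : ℕ) :
    hyperfactorial (m + n) = hyperfactorial m * ∏ t ∈ range n, (m + t).factorial :=
  prod_range_add _ _ _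

theorem vandermonde_step_mul_hyperfactorial (a b c : ℕ) :
    (Matrix.vandermonde fun i : Fin (b + a) => (((if (i : ℕ) < b then 0 else c) + i : ℕ) : ℤ)).det *
        hyperfactorial (a + c) * hyperfactorial (b + c) =
      hyperfactorial (a + b + c) * hyperfactorial a * hyperfactorial b * hyperfactorial c := by
  rw [det_vandermonde_eq_prod_range (b + a)
    fun i => (((if i < b then 0 else c) + i : ℕ) : ℤ), prod_range_add]
  have h₁ : ∏ j ∈ range b, ∏ i ∈ range j, ((((if j < b then 0 else c) + j : ℕ) : ℤ) -
      ((if i < b then 0 else c) + i : ℕ)) = hyperfactorial b := by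
    rw [hyperfactorial, Nat.cast_prod]
    refine prod_congr rfl fun j hj => ?_
    rw [← Nat.descFactorial_self, ← prod_range_cast_sub le_rfl]
    refine prod_congr rfl fun i hi => ?_
    rw [mem_range] at hi hj
    rw [if_pos hj, if_pos (hi.trans hj), zero_add, zero_add]
  have h₂ : ∏ t ∈ range a, ∏ i ∈ range (b + t),
      ((((if b + t < b then 0 else c) + (b + t) : ℕ) : ℤ) - ((if i < b then 0 else c) + i : ℕ)) =
      ∏ t ∈ range a, ((((b + c + t).descFactorial b : ℕ) : ℤ) * t.factorial) := by
    refine prod_congr rfl fun t _ => ?_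
    rw [prod_range_add]
    congr 1
    · rw [← prod_range_cast_sub (by omega)]
      refine prod_congr rfl fun i hi => ?_
      rw [if_neg (by omega), if_pos (mem_range.1 hi)]
      push_cast
      ring
    · rw [← Nat.descFactorial_self, ← prod_range_cast_sub le_rfl]
      refine prod_congr rfl fun i _ => ?_
      rw [if_neg (by omega), if_neg (by omega)]
      push_cast
      ring
  have h₃ : (∏ t ∈ range a, (c + t).factorial) * ∏ t ∈ range a, (b + c + t).descFactorial b =
      ∏ t ∈ range a, (b + c + t).factorial := by
    rw [← prod_mul_distrib]
    refine prod_congr rfl fun t _ => ?_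
    rw [← Nat.factorial_mul_descFactorial (n := b + c + t) (k := b) (by omega)]
    congr 2
    omega
  rw [h₁, h₂, show a + b + c = b + c + a by ring, add_comm a c, hyperfactorial_add (b + c),
    hyperfactorial_add c, prod_mul_distrib, ← h₃]
  simp only [hyperfactorial]
  push_cast
  ring

theorem le_of_mem_gtPatterns {n : ℕ} {x : Fin n → ℕ} {T : ℕ → ℕ → ℕ} (hT : T ∈ gtPatterns n x)
    {p p' q q' : ℕ} (hp : p ≤ p') (hq : q' ≤ q) (h : p' + q < n) : T p q ≤ T p' q' := by
  obtain ⟨-, -, hT⟩ := mem_gtPatterns.1 hT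
  trans T p' q
  · induction p', hp using Nat.le_induction with
    | base => rfl
    | succ r hr ih => exact (ih (by omega)).trans (hT r q (by omega)).2
  · induction q, hq using Nat.le_induction with
    | base => rfl
    | succ r hr ih => exact (hT p' r (by omega)).1.trans (ih (by omega))

/-- The top row `(0, …, 0, c, …, c)` with `b` zeros followed by `a` entries `c`. -/
def stepRow (a b c : ℕ) (i : Fin (b + a)) : ℕ := if (i : ℕ) < b then 0 else c

theorem monotone_stepRow (a b c : ℕ) : Monotone (stepRow a b c) := by
  intro i j hij
  have := Fin.le_def.1 hij
  unfold stepRow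
  split_ifs <;> omega

theorem mem_gtPatterns_stepRow {a b c : ℕ} {T : ℕ → ℕ → ℕ} :
    T ∈ gtPatterns (b + a) (stepRow a b c) ↔
      (∀ p q, b + a ≤ p + q → T p q = 0) ∧
      (∀ p q, p + q < b + a → b ≤ p → T p q = c) ∧
      (∀ p q, p + q < b + a → a ≤ q → T p q = 0) ∧
      (∀ p q, p < b → q < a → T p q ≤ c) ∧
      (∀ p q, p < b → q + 1 < a → T p (q + 1) ≤ T p q) ∧
      (∀ p q, p + 1 < b → q < a → T p q ≤ T (p + 1) q) := by
  constructor
  · intro hT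
    obtain ⟨h0, h1, h2⟩ := mem_gtPatterns.1 hT
    have hc : ∀ p q, p + q < b + a → T p q ≤ c := by
      intro p q h
      refine (le_of_mem_gtPatterns hT (p' := b + a - 1 - q) (by omega) le_rfl (by omega)).trans ?_
      have := h1 ⟨b + a - 1 - q, by omega⟩
      simp only [stepRow] at this
      rw [show b + a - 1 - (b + a - 1 - q) = q by omega] at this
      rw [this]
      split_ifs <;> omega
    refine ⟨h0, fun p q h hp => (hc p q h).antisymm ?_, fun p q h hq => ?_,
      fun p q hp hq => hc p q (by omega), fun p q hp hq => (h2 p q (by omega)).1,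
      fun p q hp hq => (h2 p q (by omega)).2⟩
    · have := h1 ⟨p, by omega⟩
      simp only [stepRow] at this
      rw [if_neg (by omega)] at this
      exact this.symm.le.trans
        (le_of_mem_gtPatterns hT le_rfl (by omega) (by omega))
    · have := h1 ⟨b + a - 1 - q, by omega⟩
      simp only [stepRow] at this
      rw [show b + a - 1 - (b + a - 1 - q) = q by omega, if_pos (by omega)] at this
      exact Nat.eq_zero_of_le_zero
        ((le_of_mem_gtPatterns hT (by omega) le_rfl (by omega)).trans this.le)
  · rintro ⟨h0, hb, ha, hc, h1, h2⟩
    refine mem_gtPatterns.2 ⟨h0, fun p => ?_, fun p q h => ⟨?_, ?_⟩⟩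
    · unfold stepRow
      split_ifs with hp
      · exact ha _ _ (by omega) (by omega)
      · exact hb _ _ (by omega) (by omega)
    · rcases Nat.lt_or_ge p b with hp | hp
      · rcases Nat.lt_or_ge (q + 1) a with hq | hq
        · exact h1 p q hp hq
        · rw [ha p (q + 1) (by omega) hq]
          exact Nat.zero_le _
      · rw [hb p q (by omega) hp, hb p (q + 1) (by omega) hp]
    · rcases Nat.lt_or_ge q a with hq | hq
      · rcases Nat.lt_or_ge (p + 1) b with hp | hp
        · exact h2 p q hp hq
        · rw [hb (p + 1) q (by omega) hp]
          rcases Nat.lt_or_ge p b with hp | hp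
          · exact hc p q hp hq
          · rw [hb p q (by omega) hp]
      · rw [ha p q (by omega) hq]
        exact Nat.zero_le _

/-- The lower set under the heights recorded by the free part of a pattern. -/
def boxOfPattern (a b c : ℕ) (T : ℕ → ℕ → ℕ) : Finset (Fin a × Fin b × Fin c) :=
  univ.filter fun t => (t.2.2 : ℕ) < T (b - 1 - t.2.1) t.1

theorem mem_boxOfPattern {a b c : ℕ} {T : ℕ → ℕ → ℕ} {t : Fin a × Fin b × Fin c} :
    t ∈ boxOfPattern a b c T ↔ (t.2.2 : ℕ) < T (b - 1 - t.2.1) t.1 := by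
  simp [boxOfPattern]

open Classical in
/-- The pattern recording the heights of a set of boxes. -/
noncomputable def patternOfBox (a b c : ℕ) (P : Finset (Fin a × Fin b × Fin c)) (p q : ℕ) : ℕ :=
  if h : p < b ∧ q < a then
    univ.sup fun k : Fin c => if (⟨q, h.2⟩, ⟨b - 1 - p, by omega⟩, k) ∈ P then (k : ℕ) + 1 else 0
  else if p + q < b + a ∧ b ≤ p then c else 0

theorem lt_patternOfBox {a b c : ℕ} {P : Finset (Fin a × Fin b × Fin c)} (hP : IsPP a b c P)
    {p q : ℕ} (hp : p < b) (hq : q < a) (k : Fin c) :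
    (k : ℕ) < patternOfBox a b c P p q ↔ (⟨q, hq⟩, ⟨b - 1 - p, by omega⟩, k) ∈ P := by
  rw [patternOfBox, dif_pos ⟨hp, hq⟩, Finset.lt_sup_iff]
  constructor
  · rintro ⟨l, -, hl⟩
    split_ifs at hl with h
    · exact hP _ h _ le_rfl le_rfl (Fin.le_def.2 (by simpa [Nat.lt_succ_iff] using hl))
    · omega
  · intro h
    exact ⟨k, mem_univ _, by rw [if_pos h]; omega⟩

theorem patternOfBox_le {a b c : ℕ} (P : Finset (Fin a × Fin b × Fin c)) (p q : ℕ) :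
    patternOfBox a b c P p q ≤ c := by
  unfold patternOfBox
  split_ifs
  · refine Finset.sup_le fun k _ => ?_
    split_ifs <;> omega
  · exact le_rfl
  · omega

theorem le_of_forall_fin_lt {c m n : ℕ} (hm : m ≤ c) (h : ∀ k : Fin c, (k : ℕ) < m → (k : ℕ) < n) :
    m ≤ n := by
  by_contra! hlt
  exact lt_irrefl _ (h ⟨n, hlt.trans_le hm⟩ hlt)

theorem patternOfBox_mem {a b c : ℕ} {P : Finset (Fin a × Fin b × Fin c)} (hP : IsPP a b c P) :
    patternOfBox a b c P ∈ gtPatterns (b + a) (stepRow a b c) := by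
  refine mem_gtPatterns_stepRow.2 ⟨fun p q h => ?_, fun p q h hp => ?_, fun p q h hq => ?_,
    fun p q _ _ => patternOfBox_le P p q, fun p q hp hq => ?_, fun p q hp hq => ?_⟩
  · rw [patternOfBox, dif_neg (by omega), if_neg (by omega)]
  · rw [patternOfBox, dif_neg (by omega), if_pos (by omega)]
  · rw [patternOfBox, dif_neg (by omega), if_neg (by omega)]
  · refine le_of_forall_fin_lt (patternOfBox_le P _ _) fun k hk => ?_
    rw [lt_patternOfBox hP hp (by omega)] at hk ⊢
    exact hP _ hk _ (Fin.le_def.2 (Nat.le_succ q)) le_rfl le_rfl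
  · refine le_of_forall_fin_lt (patternOfBox_le P _ _) fun k hk => ?_
    rw [lt_patternOfBox hP (by omega) hq] at hk ⊢
    exact hP _ hk _ le_rfl (Fin.le_def.2 (by simp only; omega)) le_rfl

theorem boxOfPattern_patternOfBox {a b c : ℕ} {P : Finset (Fin a × Fin b × Fin c)}
    (hP : IsPP a b c P) : boxOfPattern a b c (patternOfBox a b c P) = P := by
  ext ⟨i, j, k⟩
  rw [mem_boxOfPattern, lt_patternOfBox hP (by omega) i.2]
  simp only [show b - 1 - (b - 1 - (j : ℕ)) = j by omega]

theorem isPP_boxOfPattern {a b c : ℕ} {T : ℕ → ℕ → ℕ}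
    (hT : T ∈ gtPatterns (b + a) (stepRow a b c)) : IsPP a b c (boxOfPattern a b c T) := by
  intro t ht s h1 h2 h3
  rw [mem_boxOfPattern] at ht ⊢
  rw [Fin.le_def] at h1 h2 h3
  exact (h3.trans_lt ht).trans_le (le_of_mem_gtPatterns hT (by omega) h1 (by omega))

theorem injOn_boxOfPattern (a b c : ℕ) :
    Set.InjOn (boxOfPattern a b c) (gtPatterns (b + a) (stepRow a b c)) := by
  have key : ∀ T ∈ gtPatterns (b + a) (stepRow a b c), ∀ T' : ℕ → ℕ → ℕ,
      boxOfPattern a b c T = boxOfPattern a b c T' → ∀ p q, p < b → q < a → T p q ≤ T' p q := by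
    intro T hT T' h p q hp hq
    refine le_of_forall_fin_lt ((mem_gtPatterns_stepRow.1 hT).2.2.2.1 p q hp hq) fun k hk => ?_
    have := Finset.ext_iff.1 h (⟨q, hq⟩, ⟨b - 1 - p, by omega⟩, k)
    simp only [mem_boxOfPattern, show b - 1 - (b - 1 - p) = p by omega] at this
    exact this.1 hk
  intro T hT T' hT' h
  ext p q
  obtain ⟨h0, hb, ha, -⟩ := mem_gtPatterns_stepRow.1 hT
  obtain ⟨h0', hb', ha', -⟩ := mem_gtPatterns_stepRow.1 hT'
  rcases Nat.lt_or_ge (p + q) (b + a) with hpq | hpq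
  · rcases Nat.lt_or_ge p b with hp | hp
    · rcases Nat.lt_or_ge q a with hq | hq
      · exact (key T hT T' h p q hp hq).antisymm (key T' hT' T h.symm p q hp hq)
      · rw [ha p q hpq hq, ha' p q hpq hq]
    · rw [hb p q hpq hp, hb' p q hpq hp]
  · rw [h0 p q hpq, h0' p q hpq]

theorem card_isPP (a b c : ℕ) :
    (univ.filter (IsPP a b c)).card = (gtPatterns (b + a) (stepRow a b c)).card := by
  symm
  refine card_bij (fun T _ => boxOfPattern a b c T) (fun T hT => ?_)
    (fun T hT T' hT' h => injOn_boxOfPattern a b c hT hT' h) (fun P hP => ?_)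
  · exact mem_filter.2 ⟨mem_univ _, isPP_boxOfPattern hT⟩
  · have hP := (mem_filter.1 hP).2
    exact ⟨patternOfBox a b c P, patternOfBox_mem hP, boxOfPattern_patternOfBox hP⟩

/-- MacMahon's box formula: the number of plane partitions in an `a × b × c` box
satisfies `N(a,b,c) · H(a+b) · H(a+c) · H(b+c) = H(a+b+c) · H(a) · H(b) · H(c)`. -/
theorem planePartition_count (a b c : ℕ) :
    (Finset.univ.filter (IsPP a b c)).card *
        hyperfactorial (a + b) * hyperfactorial (a + c) * hyperfactorial (b + c) =
      hyperfactorial (a + b + c) * hyperfactorial a * hyperfactorial b * hyperfactorial c := by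
  have h : ((hyperfactorial (a + b) : ℕ) : ℤ) = ∏ j : Fin (b + a), ((j : ℕ).factorial : ℤ) := by
    rw [hyperfactorial, Nat.cast_prod, add_comm,
      Fin.prod_univ_eq_prod_range fun j => ((j.factorial : ℕ) : ℤ)]
  zify
  rw [← vandermonde_step_mul_hyperfactorial, card_isPP, card_gtPatterns _ (monotone_stepRow a b c),
    h, mul_comm _ (∏ j : Fin (b + a), _), prod_factorial_mul_det_choose]
  rfl
end

section
/- For all natural numbers a, b, c, the number of self-complementary plane partitions in the a×b×c box equals the signed count of all plane partitions in the box: #{T ∈ PP(a,b,c) : κ(T) = T} = ∑_{T ∈ PP(a,b,c)} (−1)^{|T|}, as an identity of integers. -/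
open Finset

/-- Complementation of plane partitions:
`κ(T) = {(i,j,k) : (a-1-i, b-1-j, c-1-k) ∉ T}`. -/
def ppKappa (a b c : ℕ) (T : Finset (Fin a × Fin b × Fin c)) :
    Finset (Fin a × Fin b × Fin c) :=
  Finset.univ.filter fun p => (p.1.rev, p.2.1.rev, p.2.2.rev) ∉ T

theorem ppKappa_isPP {a b c : ℕ} {T : Finset (Fin a × Fin b × Fin c)}
    (hT : IsPP a b c T) : IsPP a b c (ppKappa a b c T) := by
  intro p hp q h1 h2 h3
  simp only [ppKappa, Finset.mem_filter, Finset.mem_univ, true_and] at hp ⊢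
  intro hq
  exact hp (hT _ hq _ (Fin.rev_le_rev.mpr h1) (Fin.rev_le_rev.mpr h2)
    (Fin.rev_le_rev.mpr h3))

/-- A positive array on an `a × b` rectangle, extended by `1` next to the last cell, by `B` next to
the first cell, and by `0` elsewhere. -/
structure IsWeightArray (a b : ℤ) (B : ℝ) (z : ℤ → ℤ → ℝ) : Prop where
  posB : 0 < B
  pos : ∀ i j, 0 ≤ i → i < a → 0 ≤ j → j < b → 0 < z i j
  corner : z a (b - 1) = 1
  source : z (-1) 0 = B
  outside : ∀ i j, (i < 0 ∨ a ≤ i ∨ j < 0 ∨ b ≤ j) → ¬ (i = a ∧ j = b - 1) →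
    ¬ (i = -1 ∧ j = 0) → z i j = 0

/-- A sequence of arrays related by birational promotion on an `a × b` rectangle. -/
structure IsBirationalPromotion (a b : ℤ) (B : ℝ) (y : ℕ → ℤ → ℤ → ℝ) : Prop where
  array : ∀ l, IsWeightArray a b B (y l)
  promote : ∀ l i j, 0 ≤ i → i < a → 0 ≤ j → j < b →
    y (l + 1) i j * y l i j * ((y l (i - 1) j)⁻¹ + (y l i (j - 1))⁻¹) =
      y (l + 1) (i + 1) j + y (l + 1) i (j + 1)

namespace IsWeightArray

variable {a b : ℤ} {B : ℝ} {z : ℤ → ℤ → ℝ}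

theorem nonneg (H : IsWeightArray a b B z) (i j : ℤ) : 0 ≤ z i j := by
  by_cases hc : i = a ∧ j = b - 1
  · rw [hc.1, hc.2, H.corner]; exact zero_le_one
  by_cases hd : i = -1 ∧ j = 0
  · rw [hd.1, hd.2, H.source]; exact H.posB.le
  by_cases hin : i < 0 ∨ a ≤ i ∨ j < 0 ∨ b ≤ j
  · rw [H.outside i j hin hc hd]
  · push Not at hin
    exact (H.pos i j hin.1 hin.2.1 hin.2.2.1 hin.2.2.2).le

theorem inv_add_inv_pos (H : IsWeightArray a b B z) (i j : ℤ) (hi : 0 ≤ i)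
    (hia : i < a) (hj : 0 ≤ j) (hjb : j < b) : 0 < (z (i - 1) j)⁻¹ + (z i (j - 1))⁻¹ := by
  have nn : ∀ i j, 0 ≤ (z i j)⁻¹ := fun i j => inv_nonneg.2 (H.nonneg i j)
  rcases hi.eq_or_lt with rfl | hi'
  · rcases hj.eq_or_lt with rfl | hj'
    · have : 0 < (z (0 - 1) 0)⁻¹ := by
        rw [zero_sub, H.source]; exact inv_pos.2 H.posB
      linarith [nn 0 (0 - 1)]
    · have := inv_pos.2 (H.pos 0 (j - 1) le_rfl hia (by lia) (by lia))
      linarith [nn (0 - 1) j]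
  · have := inv_pos.2 (H.pos (i - 1) j (by lia) (by lia) hj hjb)
    linarith [nn i (j - 1)]

end IsWeightArray

/-- `F` is the generating function of lattice paths from `(s, 0)` with vertex weights
`y i j / (y (i + 1) j + y i (j + 1))`. -/
structure IsPathWeight (a b : ℤ) (y : ℤ → ℤ → ℝ) (s : ℤ) (F : ℤ → ℤ → ℝ) : Prop where
  outside : ∀ i j, (i < 0 ∨ a ≤ i ∨ j < 0 ∨ b ≤ j) → F i j = 0
  step : ∀ i j, 0 ≤ i → i < a → 0 ≤ j → j < b →
    F i j * (y (i + 1) j + y i (j + 1)) =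
      y i j * (F (i - 1) j + F i (j - 1) + if i = s ∧ j = 0 then 1 else 0)

/-- Sum of `F i j * (y (i + 1) j + y i (j + 1))` along the antidiagonal from `(i - 1, j)`. -/
noncomputable def diagSum (y F : ℤ → ℤ → ℝ) (i j : ℤ) : ℝ :=
  ∑ m ∈ Finset.range i.toNat,
    F (i - 1 - m) (j + m) * (y (i - m) (j + m) + y (i - 1 - m) (j + m + 1))

section PathWeight

variable {a b s : ℤ} {y F : ℤ → ℤ → ℝ}

theorem diagSum_of_nonpos {i : ℤ} (hi : i ≤ 0) (j : ℤ) : diagSum y F i j = 0 := by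
  simp [diagSum, Int.toNat_of_nonpos hi]

theorem IsPathWeight.diagSum_eq (h : IsPathWeight a b y s F) (i j : ℤ) :
    diagSum y F i j = F (i - 1) j * (y i j + y (i - 1) (j + 1)) + diagSum y F (i - 1) (j + 1) := by
  rcases le_or_gt i 0 with hi | hi
  · rw [diagSum_of_nonpos hi, diagSum_of_nonpos (by lia), h.outside _ _ (Or.inl (by lia))]
    simp
  · obtain ⟨n, rfl⟩ : ∃ n : ℕ, i = n + 1 := ⟨(i - 1).toNat, by lia⟩
    have e1 : ((n : ℤ) + 1).toNat = n + 1 := by lia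
    have e2 : ((n : ℤ) + 1 - 1).toNat = n := by lia
    unfold diagSum
    rw [e1, e2, Finset.sum_range_succ']
    rw [add_comm]
    congr 1
    · simp
    · apply Finset.sum_congr rfl
      intro m _
      push_cast
      ring_nf

theorem IsPathWeight.diagSum_of_le (h : IsPathWeight a b y s F) (i j : ℤ) (hj : b ≤ j) :
    diagSum y F i j = 0 := by
  apply Finset.sum_eq_zero
  intro m _
  rw [h.outside _ _ (by lia), zero_mul]

theorem IsPathWeight.inflow (h : IsPathWeight a b y s F) (hs : 0 ≤ s)
    (hy : ∀ i j, (i < 0 ∨ a ≤ i ∨ j < 0 ∨ b ≤ j) → ¬ (i = a ∧ j = b - 1) →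
      ¬ (i = -1 ∧ j = 0) → y i j = 0)
    (i j : ℤ) (hij : ¬ (i = a ∧ j = b - 1)) :
    F i j * (y (i + 1) j + y i (j + 1)) =
      y i j * (F (i - 1) j + F i (j - 1) + if i = s ∧ j = 0 then 1 else 0) := by
  by_cases hin : i < 0 ∨ a ≤ i ∨ j < 0 ∨ b ≤ j
  · rw [h.outside i j hin]
    by_cases h2 : i = -1 ∧ j = 0
    · rw [h.outside (i - 1) j (by lia), h.outside i (j - 1) (by lia), if_neg (by lia)]
      simp
    · rw [hy i j hin hij h2]
      simp
  · push Not at hin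
    exact h.step i j hin.1 hin.2.1 hin.2.2.1 hin.2.2.2

theorem IsPathWeight.diagSum_flow (h : IsPathWeight a b y s F) (hs : 0 ≤ s)
    (hy : ∀ i j, (i < 0 ∨ a ≤ i ∨ j < 0 ∨ b ≤ j) → ¬ (i = a ∧ j = b - 1) →
      ¬ (i = -1 ∧ j = 0) → y i j = 0)
    (n : ℕ) (j : ℤ) (hj : 0 ≤ j) (hnj : n + j ≤ a + b - 1) :
    diagSum y F n j = diagSum y F (n - 1) j + F (n - 1) (j - 1) * y (n - 1) j +
      if (n : ℤ) = s + 1 ∧ j = 0 then y s 0 else 0 := by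
  induction n generalizing j with
  | zero =>
    rw [diagSum_of_nonpos (by simp), diagSum_of_nonpos (by simp), h.outside _ _ (by lia),
      if_neg (by lia)]
    simp
  | succ n ih =>
    have e1 := h.diagSum_eq ((n + 1 : ℕ) : ℤ) j
    have e2 := ih (j + 1) (by lia) (by push_cast at hnj; lia)
    have e3 := h.diagSum_eq (n : ℤ) j
    have e4 := h.inflow hs hy n j (by push_cast at hnj; lia)
    push_cast at e1 ⊢
    simp only [add_sub_cancel_right] at e1 e2 ⊢
    rw [if_neg (by lia)] at e2
    rw [e1, e2, e4, e3]
    by_cases hh : (n : ℤ) = s ∧ j = 0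
    · rw [if_pos hh, if_pos (by lia), hh.1, hh.2]
      ring
    · rw [if_neg hh, if_neg (by lia)]
      ring

theorem IsPathWeight.last (h : IsPathWeight a b y s F) (hs : 0 ≤ s) (hsa : s < a)
    (hy : ∀ i j, (i < 0 ∨ a ≤ i ∨ j < 0 ∨ b ≤ j) → ¬ (i = a ∧ j = b - 1) →
      ¬ (i = -1 ∧ j = 0) → y i j = 0) (hb : 0 < b) (hc : y a (b - 1) = 1) :
    F (a - 1) (b - 1) = y s 0 := by
  have key : ∀ n : ℕ, (n : ℤ) ≤ a + b - 1 →
      diagSum y F n 0 = if s + 1 ≤ (n : ℤ) then y s 0 else 0 := by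
    intro n
    induction n with
    | zero => intro _; rw [if_neg (by lia)]; simp [diagSum]
    | succ n ih =>
      intro hn
      have := h.diagSum_flow hs hy (n + 1) 0 le_rfl (by lia)
      rw [this, h.outside _ (0 - 1) (by lia)]
      push_cast at hn ⊢
      rw [add_sub_cancel_right, ih (by lia)]
      by_cases h1 : s + 1 ≤ (n : ℤ)
      · rw [if_pos h1, if_neg (by lia), if_pos (by lia)]; ring
      · rw [if_neg h1]
        by_cases h2 : (n : ℤ) = s
        · rw [if_pos (by lia), if_pos (by lia)]; ring
        · rw [if_neg (by lia), if_neg (by lia)]; ring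
  have h1 := key (a + b - 1).toNat (by lia)
  rw [if_pos (by lia), Int.toNat_of_nonneg (by lia)] at h1
  rw [← h1]
  unfold diagSum
  rw [Finset.sum_eq_single (b - 1).toNat]
  · rw [Int.toNat_of_nonneg (by lia)]
    have e1 : a + b - 1 - 1 - (b - 1) = a - 1 := by ring
    have e2 : a + b - 1 - (b - 1) = a := by ring
    rw [e1, e2, zero_add, hc, hy (a - 1) _ (by lia) (by lia) (by lia)]
    ring
  · intro m _ hm
    rw [h.outside _ _ (by lia), zero_mul]
  · intro hm
    simp only [Finset.mem_range] at hm
    lia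

end PathWeight

namespace IsBirationalPromotion

variable {a b : ℤ} {B : ℝ} {y : ℕ → ℤ → ℤ → ℝ}

theorem posB (H : IsBirationalPromotion a b B y) : 0 < B := (H.array 0).posB

theorem pos (H : IsBirationalPromotion a b B y) (l : ℕ) (i j : ℤ) (hi : 0 ≤ i)
    (hia : i < a) (hj : 0 ≤ j) (hjb : j < b) : 0 < y l i j := (H.array l).pos i j hi hia hj hjb

theorem corner (H : IsBirationalPromotion a b B y) (l : ℕ) : y l a (b - 1) = 1 :=
  (H.array l).corner

theorem source (H : IsBirationalPromotion a b B y) (l : ℕ) : y l (-1) 0 = B :=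
  (H.array l).source

theorem outside (H : IsBirationalPromotion a b B y) (l : ℕ) (i j : ℤ)
    (h : i < 0 ∨ a ≤ i ∨ j < 0 ∨ b ≤ j) (h1 : ¬ (i = a ∧ j = b - 1)) (h2 : ¬ (i = -1 ∧ j = 0)) :
    y l i j = 0 := (H.array l).outside i j h h1 h2

theorem exists_pathWeight (H : IsBirationalPromotion a b B y) (hb : 0 < b) (l n : ℕ)
    (hn : (n : ℤ) < a) :
    ∃ F, IsPathWeight a b (y (l + n + 1)) n F ∧
      ∀ s : ℤ, 0 ≤ s → s + n < a → F (s + n) (b - 1) = B * (y l s (b - 1))⁻¹ := by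
  induction n with
  | zero =>
    refine ⟨fun i j => if i < 0 ∨ a ≤ i ∨ j < 0 ∨ b ≤ j then 0 else B * (y l i j)⁻¹, ⟨?_, ?_⟩, ?_⟩
    · intro i j h
      simp only [if_pos h]
    · intro i j hi hia hj hjb
      have hy := H.pos l i j hi hia hj hjb
      simp only [add_zero]
      rw [← H.promote l i j hi hia hj hjb, if_neg (by lia)]
      have hB := H.posB.ne'
      have hy' := hy.ne'
      have h1 : (if i - 1 < 0 ∨ a ≤ i - 1 ∨ j < 0 ∨ b ≤ j then 0 else B * (y l (i - 1) j)⁻¹) +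
          (if i = ((0 : ℕ) : ℤ) ∧ j = 0 then 1 else 0) = B * (y l (i - 1) j)⁻¹ := by
        by_cases h0 : i = 0
        · subst h0
          by_cases hj0 : j = 0
          · subst hj0
            rw [zero_sub, H.source]
            simp [hB]
          · rw [zero_sub, H.outside l (-1) j (by lia) (by lia) (by lia)]
            simp [hj0]
        · rw [if_neg (by lia), if_neg (by push_cast; lia), add_zero]
      have h2 : (if i < 0 ∨ a ≤ i ∨ j - 1 < 0 ∨ b ≤ j - 1 then 0 else B * (y l i (j - 1))⁻¹) =
          B * (y l i (j - 1))⁻¹ := by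
        by_cases hj0 : j = 0
        · subst hj0
          rw [H.outside l i (0 - 1) (by lia) (by lia) (by lia)]
          simp
        · rw [if_neg (by lia)]
      rw [add_right_comm (_ : ℝ), h1, h2]
      field_simp
    · intro s hs hsa
      push_cast at hsa ⊢
      rw [if_neg (by lia), add_zero]
  | succ n ih =>
    obtain ⟨F, hF, hFs⟩ := ih (by push_cast at hn; lia)
    set z := y (l + n + 1) with hz
    have hy := H.outside (l + n + 1)
    rw [← hz] at hy
    push_cast at hn
    have hzp : ∀ i j, 0 ≤ i → i < a → 0 ≤ j → j < b → z i j ≠ 0 :=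
      fun i j h1 h2 h3 h4 => (H.pos (l + n + 1) i j h1 h2 h3 h4).ne'
    refine ⟨fun i j => if i < 0 ∨ a ≤ i ∨ j < 0 ∨ b ≤ j then 0 else (z i j)⁻¹ * diagSum z F i j,
      ⟨?_, ?_⟩, ?_⟩
    · intro i j h
      simp only [if_pos h]
    · intro i j hi hia hj hjb
      have hp := H.promote (l + n + 1) i j hi hia hj hjb
      rw [← hz] at hp
      rw [show l + (n + 1) + 1 = l + n + 1 + 1 by ring, ← hp, if_neg (by lia)]
      have hzij := hzp i j hi hia hj hjb
      have fl := hF.diagSum_flow (by lia) hy i.toNat j hj (by lia)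
      rw [Int.toNat_of_nonneg hi] at fl
      have dg := hF.diagSum_eq i (j - 1)
      rw [sub_add_cancel] at dg
      have h1 : (if i - 1 < 0 ∨ a ≤ i - 1 ∨ j < 0 ∨ b ≤ j then 0
            else (z (i - 1) j)⁻¹ * diagSum z F (i - 1) j) +
          (if i = ((n + 1 : ℕ) : ℤ) ∧ j = 0 then 1 else 0) =
          (z (i - 1) j)⁻¹ * diagSum z F i j - F (i - 1) (j - 1) := by
        by_cases h0 : i = 0
        · subst h0
          rw [if_pos (by lia), if_neg (by push_cast; lia), diagSum_of_nonpos le_rfl,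
            hF.outside _ _ (by lia)]
          simp
        · have hz1 := hzp (i - 1) j (by lia) (by lia) hj hjb
          rw [if_neg (by lia), fl]
          push_cast
          by_cases hh : i = n + 1 ∧ j = 0
          · rw [if_pos hh, if_pos hh]
            have : i - 1 = n := by lia
            rw [this, hh.2] at hz1 ⊢
            field_simp
            ring
          · rw [if_neg hh, if_neg hh]
            field_simp
            ring
      have h2 : (if i < 0 ∨ a ≤ i ∨ j - 1 < 0 ∨ b ≤ j - 1 then 0
            else (z i (j - 1))⁻¹ * diagSum z F i (j - 1)) =
          (z i (j - 1))⁻¹ * diagSum z F i j + F (i - 1) (j - 1) := by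
        by_cases hj0 : j = 0
        · subst hj0
          rw [if_pos (by lia), hF.outside _ _ (by lia), hy _ (0 - 1) (by lia) (by lia) (by lia)]
          simp
        · have hz1 := hzp i (j - 1) hi hia (by lia) (by lia)
          rw [if_neg (by lia), dg, fl, if_neg (by lia)]
          field_simp
          ring
      rw [add_right_comm (_ : ℝ), h1, h2]
      field_simp
      ring
    · intro t ht hta
      push_cast at hta ⊢
      rw [if_neg (by lia), hF.diagSum_eq, hF.diagSum_of_le _ _ (by lia),
        show t + (n + 1 : ℤ) - 1 = t + n by ring, hFs t ht (by lia), hy (t + n) _ (by lia) (by lia)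
          (by lia)]
      have hz1 := hzp (t + (n + 1)) (b - 1) (by lia) (by lia) (by lia) (by lia)
      field_simp
      ring

theorem reciprocity_zero (H : IsBirationalPromotion a b B y) (hb : 0 < b) (l n : ℕ)
    (hn : (n : ℤ) < a) : y (l + n + 1) n 0 = B * (y l (a - 1 - n) (b - 1))⁻¹ := by
  obtain ⟨F, hF, hs⟩ := H.exists_pathWeight hb l n hn
  rw [← hs (a - 1 - n) (by lia) (by lia), sub_add_cancel]
  exact (hF.last (by lia) hn (H.outside _) hb (H.corner _)).symm

theorem reciprocity (H : IsBirationalPromotion a b B y) (l m n : ℕ)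
    (hm : (m : ℤ) < a) (hn : (n : ℤ) < b) :
    y (l + m + n + 1) m n * y l (a - 1 - m) (b - 1 - n) = B := by
  induction n using Nat.strong_induction_on generalizing l m with
  | _ n ih =>
  rcases n with _ | j
  · have := H.pos l (a - 1 - m) (b - 1) (by lia) (by lia) (by lia) (by lia)
    simp only [Nat.cast_zero, add_zero, sub_zero]
    rw [H.reciprocity_zero (by lia) l m hm]
    field_simp
  · push_cast at hn ⊢
    have pos := fun l i j (h1 : 0 ≤ i) (h2 : i < a) (h3 : 0 ≤ j) (h4 : j < b) =>
      (H.pos l i j h1 h2 h3 h4).ne'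
    have hB := H.posB.ne'
    have p1 := H.promote (l + m + j + 1) m j (by lia) hm (by lia) (by lia)
    have p2 := H.promote l (a - 1 - m) (b - 1 - j) (by lia) (by lia) (by lia) (by lia)
    have q1 := ih j (by lia) l m hm (by lia)
    have q2 := ih j (by lia) (l + 1) m hm (by lia)
    have u1 : (y (l + m + j + 1) (m - 1) j)⁻¹ = y (l + 1) (a - 1 - m + 1) (b - 1 - j) / B := by
      rcases m with _ | m
      · rcases Nat.eq_zero_or_pos j with rfl | hj
        · simp [H.source, H.corner]
        · rw [H.outside _ _ (j : ℤ) (by push_cast; lia) (by push_cast; lia) (by push_cast; lia),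
            H.outside _ (a - 1 - (0 : ℕ) + 1) _ (by push_cast; lia) (by push_cast; lia)
              (by push_cast; lia)]
          simp
      · have := ih j (by lia) (l + 1) m (by push_cast at hm; lia) (by lia)
        have hp := pos (l + 1) (a - 1 - m) (b - 1 - j) (by lia) (by push_cast at hm; lia) (by lia)
          (by lia)
        push_cast at hm ⊢
        rw [show l + (m + 1) + j + 1 = l + 1 + m + j + 1 by ring, add_sub_cancel_right,
          show a - 1 - ((m : ℤ) + 1) + 1 = a - 1 - m by ring]
        rw [← this]
        field_simp
    have u2 : (y (l + m + j + 1) m (j - 1))⁻¹ = y (l + 1) (a - 1 - m) (b - 1 - j + 1) / B := by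
      rcases j with _ | j
      · rw [H.outside _ _ _ (by push_cast; lia) (by push_cast; lia) (by push_cast; lia),
            H.outside _ (a - 1 - m) _ (by push_cast; lia) (by push_cast; lia)
              (by push_cast; lia)]
        simp
      · have := ih j (by lia) (l + 1) m hm (by push_cast at hn; lia)
        have hp := pos (l + 1) (a - 1 - m) (b - 1 - j) (by lia) (by lia) (by push_cast at hn; lia)
          (by lia)
        push_cast at hn ⊢
        rw [show l + m + (j + 1) + 1 = l + 1 + m + j + 1 by ring, add_sub_cancel_right,
          show b - 1 - ((j : ℤ) + 1) + 1 = b - 1 - j by ring]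
        rw [← this]
        field_simp
    have u3 : y (l + m + j + 1 + 1) (m + 1) j = B * (y l (a - 1 - m - 1) (b - 1 - j))⁻¹ := by
      by_cases hma : (m : ℤ) + 1 < a
      · have := ih j (by lia) l (m + 1) (by push_cast; lia) (by lia)
        push_cast at this
        have hp := pos l (a - 1 - (m + 1)) (b - 1 - j) (by lia) (by lia) (by lia) (by lia)
        rw [show l + m + j + 1 + 1 = l + (m + 1) + j + 1 by ring,
          show a - 1 - (m : ℤ) - 1 = a - 1 - (m + 1) by ring, ← this]
        field_simp
      · rw [H.outside _ ((m : ℤ) + 1) _ (by lia) (by lia) (by lia),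
          H.outside l (a - 1 - m - 1) _ (by lia) (by lia) (by lia)]
        simp
    have hp1 := pos l (a - 1 - m) (b - 1 - j) (by lia) (by lia) (by lia) (by lia)
    have hp2 := pos (l + 1) (a - 1 - m) (b - 1 - j) (by lia) (by lia) (by lia) (by lia)
    have hp3 := pos l (a - 1 - m) (b - 1 - (j + 1)) (by lia) (by lia) (by lia) (by lia)
    rw [u1, u2, u3] at p1
    rw [show b - 1 - (j : ℤ) - 1 = b - 1 - (j + 1) by ring] at p2
    rw [show l + m + (j + 1) + 1 = l + m + j + 1 + 1 by ring]
    rw [show l + 1 + m + j + 1 = l + m + j + 1 + 1 by ring] at q2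
    have q1' := eq_div_of_mul_eq hp1 q1
    have q2' := eq_div_of_mul_eq hp2 q2
    rw [q1', q2', ← add_div, ← p2] at p1
    rw [← sub_eq_iff_eq_add'] at p1
    rw [← p1]
    field_simp
    ring

end IsBirationalPromotion

section Group

variable {G : Type*} [Group G]

/-- The product `r (m - 1) * ⋯ * r 1 * r 0`. -/
def sweep (r : ℕ → G) : ℕ → G
  | 0 => 1
  | m + 1 => r m * sweep r m

/-- The product `sweep r 1 * sweep r 2 * ⋯ * sweep r m`. -/
def evacuation (r : ℕ → G) : ℕ → G
  | 0 => 1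
  | m + 1 => evacuation r m * sweep r (m + 1)

/-- The product of the `r k` for `k < m` of parity opposite to `m`. -/
def alternate (r : ℕ → G) : ℕ → G
  | 0 => 1
  | 1 => r 0
  | m + 2 => alternate r m * r (m + 1)

theorem commute_sweep {r : ℕ → G} {g : G} {m : ℕ} (h : ∀ k < m, Commute g (r k)) :
    Commute g (sweep r m) := by
  induction m with
  | zero => exact Commute.one_right g
  | succ m ih => exact (h m m.lt_succ_self).mul_right (ih fun k hk => h k (by lia))

theorem commute_evacuation {r : ℕ → G} {g : G} {m : ℕ} (h : ∀ k < m, Commute g (r k)) :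
    Commute g (evacuation r m) := by
  induction m with
  | zero => exact Commute.one_right g
  | succ m ih => exact (ih fun k hk => h k (by lia)).mul_right (commute_sweep h)

theorem sweep_mul_evacuation_succ {r : ℕ → G} (hr : ∀ k, r k * r k = 1)
    (hc : ∀ k l, k + 2 ≤ l → Commute (r l) (r k)) (m : ℕ) :
    sweep r (m + 1) * evacuation r (m + 1) = evacuation r m := by
  induction m with
  | zero => simp [sweep, evacuation, hr]
  | succ m ih =>
    have h1 := (commute_evacuation (r := r) (g := r (m + 1)) (m := m)
      fun k hk => hc k (m + 1) (by lia)).eq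
    rw [evacuation, sweep, ← mul_assoc, mul_assoc (r (m + 1)), ih, h1, mul_assoc,
      ← mul_assoc (r (m + 1)), hr, one_mul, evacuation]

theorem exists_conj_evacuation_alternate {r : ℕ → G} (hr : ∀ k, r k * r k = 1)
    (hc : ∀ k l, k + 2 ≤ l → Commute (r l) (r k)) (m : ℕ) :
    ∃ g, (∀ x, (∀ k < m, Commute x (r k)) → Commute x g) ∧
      g * evacuation r m * g⁻¹ = alternate r m := by
  induction m using Nat.twoStepInduction with
  | zero => exact ⟨1, fun x _ => Commute.one_right x, by simp [evacuation, alternate]⟩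
  | one => exact ⟨1, fun x _ => Commute.one_right x, by simp [evacuation, alternate, sweep]⟩
  | more m ih _ =>
    obtain ⟨g, hg, h⟩ := ih
    refine ⟨g * sweep r (m + 1), fun x hx => (hg x fun k hk => hx k (by lia)).mul_right
      (commute_sweep fun k hk => hx k (by lia)), ?_⟩
    have h1 := sweep_mul_evacuation_succ hr hc m
    have h2 := (hg (r (m + 1)) fun k hk => hc k (m + 1) (by lia)).inv_right.eq
    calc g * sweep r (m + 1) * evacuation r (m + 2) * (g * sweep r (m + 1))⁻¹
        = g * (sweep r (m + 1) * evacuation r (m + 1)) * (r (m + 1) * g⁻¹) := by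
          rw [evacuation, sweep.eq_2 r (m + 1), mul_inv_rev]; group
      _ = alternate r (m + 2) := by
          rw [h1, h2, alternate, ← h]; group

end Group

/-- A height function of a plane partition in an `a × b × c` box, extended to `ℤ × ℤ` by `c`
above and to the left and by `0` below and to the right. -/
structure IsHeightFn (a b c : ℕ) (h : ℤ → ℤ → ℤ) : Prop where
  top : ∀ i j, i < 0 ∨ j < 0 → h i j = c
  bot : ∀ i j : ℤ, 0 ≤ i → 0 ≤ j → a ≤ i ∨ b ≤ j → h i j = 0
  nonneg : ∀ i j, 0 ≤ h i j
  le_top : ∀ i j, h i j ≤ c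
  anti_left : ∀ i j, h (i + 1) j ≤ h i j
  anti_right : ∀ i j, h i (j + 1) ≤ h i j

open Classical in
/-- Reflect the values on `S` within the interval permitted by the neighbouring values. -/
noncomputable def toggle (S : ℤ → ℤ → Prop) (h : ℤ → ℤ → ℤ) (i j : ℤ) : ℤ :=
  if S i j then max (h (i + 1) j) (h i (j + 1)) + min (h (i - 1) j) (h i (j - 1)) - h i j
  else h i j

/-- No cell of `S` has a neighbour in `T`. -/
def NotAdjacent (S T : ℤ → ℤ → Prop) : Prop :=
  ∀ i j, S i j → ¬ T (i + 1) j ∧ ¬ T i (j + 1) ∧ ¬ T (i - 1) j ∧ ¬ T i (j - 1)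

theorem toggle_toggle {S T : ℤ → ℤ → Prop} (hST : NotAdjacent S T) (hd : ∀ i j, S i j → ¬ T i j)
    (h : ℤ → ℤ → ℤ) : toggle S (toggle T h) = toggle (fun i j => S i j ∨ T i j) h := by
  funext i j
  by_cases hS : S i j
  · obtain ⟨h1, h2, h3, h4⟩ := hST i j hS
    simp [toggle, hS, hd i j hS, h1, h2, h3, h4]
  · by_cases hT : T i j
    · simp only [toggle, if_neg hS, if_pos hT, if_pos (Or.inr hT : S i j ∨ T i j)]
    · simp only [toggle, if_neg hS, if_neg hT, if_neg (not_or.2 ⟨hS, hT⟩)]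

theorem toggle_involutive {S : ℤ → ℤ → Prop} (hS : NotAdjacent S S) :
    Function.Involutive (toggle S) := by
  intro h
  funext i j
  by_cases hi : S i j
  · obtain ⟨h1, h2, h3, h4⟩ := hS i j hi
    simp [toggle, hi, h1, h2, h3, h4]
  · simp [toggle, hi]

theorem IsHeightFn.modify {a b c : ℕ} {h g : ℤ → ℤ → ℤ} (H : IsHeightFn a b c h)
    {S : ℤ → ℤ → Prop} (hS : NotAdjacent S S)
    (hin : ∀ i j, S i j → 0 ≤ i ∧ i < a ∧ 0 ≤ j ∧ j < b) (hout : ∀ i j, ¬ S i j → g i j = h i j)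
    (hg : ∀ i j, S i j → max (h (i + 1) j) (h i (j + 1)) ≤ g i j ∧
      g i j ≤ min (h (i - 1) j) (h i (j - 1))) : IsHeightFn a b c g := by
  have hval : ∀ i j, max (h (i + 1) j) (h i (j + 1)) ≤ g i j ∧
      g i j ≤ min (h (i - 1) j) (h i (j - 1)) := by
    intro i j
    have h1 := H.anti_left i j
    have h2 := H.anti_right i j
    have h3 := H.anti_left (i - 1) j
    have h4 := H.anti_right i (j - 1)
    rw [sub_add_cancel] at h3 h4
    by_cases hij : S i j
    · exact hg i j hij
    · rw [hout i j hij]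
      constructor <;> lia
  refine ⟨?_, ?_, ?_, ?_, ?_, ?_⟩
  · intro i j hij
    rw [hout i j fun hh => by have := hin i j hh; lia, H.top i j hij]
  · intro i j hi hj hij
    rw [hout i j fun hh => by have := hin i j hh; lia, H.bot i j hi hj hij]
  · intro i j
    have := H.nonneg (i + 1) j
    have := (hval i j).1
    lia
  · intro i j
    have := H.le_top (i - 1) j
    have := (hval i j).2
    lia
  · intro i j
    have h1 := hval i j
    have h2 := hval (i + 1) j
    rw [add_sub_cancel_right] at h2
    by_cases hij : S i j
    · rw [hout (i + 1) j (hS i j hij).1]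
      lia
    · rw [hout i j hij]
      lia
  · intro i j
    have h1 := hval i j
    have h2 := hval i (j + 1)
    rw [add_sub_cancel_right] at h2
    by_cases hij : S i j
    · rw [hout i (j + 1) (hS i j hij).2.1]
      lia
    · rw [hout i j hij]
      lia

theorem IsHeightFn.toggle {a b c : ℕ} {h : ℤ → ℤ → ℤ} (H : IsHeightFn a b c h)
    {S : ℤ → ℤ → Prop} (hS : NotAdjacent S S)
    (hin : ∀ i j, S i j → 0 ≤ i ∧ i < a ∧ 0 ≤ j ∧ j < b) : IsHeightFn a b c (toggle S h) := by
  refine H.modify hS hin (fun i j hij => if_neg hij) fun i j hij => ?_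
  have h1 := H.anti_left i j
  have h2 := H.anti_right i j
  have h3 := H.anti_left (i - 1) j
  have h4 := H.anti_right i (j - 1)
  rw [sub_add_cancel] at h3 h4
  rw [_root_.toggle, if_pos hij]
  constructor <;> lia

section Toggles

variable (a b c : ℕ)

/-- The cells of the `a × b` rectangle on its `k`-th antidiagonal, counted from the far corner. -/
def antidiag (k : ℕ) (i j : ℤ) : Prop :=
  (0 ≤ i ∧ i < a ∧ 0 ≤ j ∧ j < b) ∧ i + j + k + 2 = a + b

theorem antidiag_notAdjacent (k l : ℕ) (h : k + 2 ≤ l ∨ l + 2 ≤ k ∨ k = l) :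
    NotAdjacent (antidiag a b k) (antidiag a b l) := by
  intro i j hij
  simp only [antidiag] at *
  refine ⟨?_, ?_, ?_, ?_⟩ <;> lia

/-- Toggling all cells of an antidiagonal. -/
noncomputable def antidiagToggle (k : ℕ) : Equiv.Perm {h // IsHeightFn a b c h} :=
  Function.Involutive.toPerm
    (fun h => ⟨toggle (antidiag a b k) h.1,
      h.2.toggle (antidiag_notAdjacent a b k k (by lia)) fun _ _ hij => hij.1⟩)
    (fun h => Subtype.ext (toggle_involutive (antidiag_notAdjacent a b k k (by lia)) h.1))

@[simp]
theorem antidiagToggle_val (k : ℕ) (h : {h // IsHeightFn a b c h}) :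
    (antidiagToggle a b c k h).1 = toggle (antidiag a b k) h.1 := rfl

theorem antidiagToggle_mul_self (k : ℕ) : antidiagToggle a b c k * antidiagToggle a b c k = 1 :=
  Equiv.ext fun h =>
    Subtype.ext (toggle_involutive (antidiag_notAdjacent a b k k (by lia)) h.1)

theorem antidiagToggle_commute (k l : ℕ) (h : k + 2 ≤ l) :
    Commute (antidiagToggle a b c l) (antidiagToggle a b c k) := by
  ext1 f
  apply Subtype.ext
  simp only [Equiv.Perm.mul_apply, antidiagToggle_val]
  rw [toggle_toggle (antidiag_notAdjacent a b l k (by lia)),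
    toggle_toggle (antidiag_notAdjacent a b k l (by lia))]
  · simp only [or_comm]
  · intro i j; simp only [antidiag]; lia
  · intro i j; simp only [antidiag]; lia

theorem alternate_antidiagToggle (m : ℕ) (h : {h // IsHeightFn a b c h}) :
    (alternate (antidiagToggle a b c) m h).1 =
      toggle (fun i j => ∃ k < m, Odd (m + k) ∧ antidiag a b k i j) h.1 := by
  induction m using Nat.twoStepInduction generalizing h with
  | zero => funext i j; simp [alternate, toggle]
  | one =>
    simp only [alternate, antidiagToggle_val]
    congr 1
    funext i j
    simp
  | more m ih _ =>
    rw [alternate, Equiv.Perm.mul_apply, ih, antidiagToggle_val, toggle_toggle]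
    · congr 1
      funext i j
      apply propext
      constructor
      · rintro (⟨k, hk, ho, hij⟩ | hij)
        · exact ⟨k, by lia, by grind, hij⟩
        · exact ⟨m + 1, by lia, by grind, hij⟩
      · rintro ⟨k, hk, ho, hij⟩
        by_cases hkm : k = m + 1
        · exact Or.inr (hkm ▸ hij)
        · exact Or.inl ⟨k, by grind, by grind, hij⟩
    · rintro i j ⟨k, hk, ho, hij⟩
      have : k ≠ m := by grind
      exact antidiag_notAdjacent a b k (m + 1) (by lia) i j hij
    · rintro i j ⟨k, hk, ho, hij⟩
      simp only [antidiag] at *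
      lia

theorem sweep_antidiagToggle_of_not (m : ℕ) (h : {h // IsHeightFn a b c h}) (i j : ℤ)
    (hij : ¬ ((0 ≤ i ∧ i < a ∧ 0 ≤ j ∧ j < b) ∧ a + b < i + j + m + 2)) :
    (sweep (antidiagToggle a b c) m h).1 i j = h.1 i j := by
  induction m with
  | zero => rfl
  | succ m ih =>
    rw [sweep, Equiv.Perm.mul_apply, antidiagToggle_val, toggle, if_neg, ih]
    · push_cast at hij; lia
    · simp only [antidiag]; push_cast at hij; lia

theorem sweep_antidiagToggle (m : ℕ) (h : {h // IsHeightFn a b c h}) (i j : ℤ)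
    (hij : 0 ≤ i ∧ i < a ∧ 0 ≤ j ∧ j < b) (hm : (a + b : ℤ) < i + j + m + 2) :
    (sweep (antidiagToggle a b c) m h).1 i j + h.1 i j =
      max ((sweep (antidiagToggle a b c) m h).1 (i + 1) j)
        ((sweep (antidiagToggle a b c) m h).1 i (j + 1)) +
      min (h.1 (i - 1) j) (h.1 i (j - 1)) := by
  induction m with
  | zero => push_cast at hm; lia
  | succ m ih =>
    push_cast at hm
    rw [sweep, Equiv.Perm.mul_apply, antidiagToggle_val]
    have h1 : ¬ antidiag a b m (i + 1) j := by simp only [antidiag]; lia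
    have h2 : ¬ antidiag a b m i (j + 1) := by simp only [antidiag]; lia
    by_cases hk : antidiag a b m i j
    · simp only [toggle, if_pos hk, if_neg h1, if_neg h2]
      have hk2 := hk.2
      rw [sweep_antidiagToggle_of_not a b c m h i j (by lia),
        sweep_antidiagToggle_of_not a b c m h (i - 1) j (by lia),
        sweep_antidiagToggle_of_not a b c m h i (j - 1) (by lia)]
      ring
    · simp only [toggle, if_neg hk, if_neg h1, if_neg h2]
      exact ih (by simp only [antidiag] at hk; lia)

end Toggles

section Promote

variable (a b : ℕ) (B : ℝ)

/-- The boundary values of weight arrays. -/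
noncomputable def weightBoundary (i j : ℤ) : ℝ :=
  if i = a ∧ j = b - 1 then 1 else if i = -1 ∧ j = 0 then B else 0

/-- The birational promotion of an array. -/
noncomputable def birationalPromote (z : ℤ → ℤ → ℝ) (i j : ℤ) : ℝ :=
  if 0 ≤ i ∧ i < a ∧ 0 ≤ j ∧ j < b then
    (birationalPromote z (i + 1) j + birationalPromote z i (j + 1)) /
      (z i j * ((z (i - 1) j)⁻¹ + (z i (j - 1))⁻¹))
  else weightBoundary a b B i j
termination_by (a + b - i - j).toNat

variable {a b B}

theorem isWeightArray_of_eq {z : ℤ → ℤ → ℝ} (hB : 0 < B)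
    (hz : ∀ i j : ℤ, 0 ≤ i → i < a → 0 ≤ j → j < b → 0 < z i j)
    (hout : ∀ i j : ℤ, ¬ (0 ≤ i ∧ i < a ∧ 0 ≤ j ∧ j < b) → z i j = weightBoundary a b B i j) :
    IsWeightArray a b B z := by
  refine ⟨hB, hz, ?_, ?_, ?_⟩
  · rw [hout _ _ (by lia), weightBoundary, if_pos (by lia)]
  · rw [hout _ _ (by lia), weightBoundary, if_neg (by lia), if_pos (by lia)]
  · intro i j h1 h2 h3
    rw [hout _ _ (by lia), weightBoundary, if_neg h2, if_neg h3]

theorem weightBoundary_nonneg (hB : 0 < B) (i j : ℤ) : 0 ≤ weightBoundary a b B i j := by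
  unfold weightBoundary
  split_ifs
  exacts [zero_le_one, hB.le, le_rfl]

theorem birationalPromote_pos {z : ℤ → ℤ → ℝ} (H : IsWeightArray a b B z) (n : ℕ) (i j : ℤ)
    (hn : (a + b - i - j).toNat = n) (hi : 0 ≤ i) (hia : i < a) (hj : 0 ≤ j) (hjb : j < b) :
    0 < birationalPromote a b B z i j := by
  induction n using Nat.strong_induction_on generalizing i j with
  | _ n ih =>
  have nn : ∀ i' j' : ℤ, 0 ≤ i' → 0 ≤ j' → (a + b - i' - j').toNat < n →
      0 ≤ birationalPromote a b B z i' j' := by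
    intro i' j' hi' hj' h
    by_cases hin : 0 ≤ i' ∧ i' < a ∧ 0 ≤ j' ∧ j' < b
    · exact (ih _ h i' j' rfl hin.1 hin.2.1 hin.2.2.1 hin.2.2.2).le
    · rw [birationalPromote, if_neg hin]
      exact weightBoundary_nonneg H.posB _ _
  have h1 := nn (i + 1) j (by lia) hj (by lia)
  have h2 := nn i (j + 1) hi (by lia) (by lia)
  rw [birationalPromote, if_pos ⟨hi, hia, hj, hjb⟩]
  refine div_pos ?_ (mul_pos (H.pos i j hi hia hj hjb) (H.inv_add_inv_pos i j hi hia hj hjb))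
  by_cases hia' : i + 1 < a
  · have := ih _ (by lia) (i + 1) j rfl (by lia) hia' hj hjb
    linarith
  by_cases hjb' : j + 1 < b
  · have := ih _ (by lia) i (j + 1) rfl hi hia (by lia) hjb'
    linarith
  have : birationalPromote a b B z (i + 1) j = 1 := by
    rw [birationalPromote, if_neg (by lia), weightBoundary, if_pos (by lia)]
  linarith

theorem isWeightArray_birationalPromote {z : ℤ → ℤ → ℝ} (H : IsWeightArray a b B z) :
    IsWeightArray a b B (birationalPromote a b B z) :=
  isWeightArray_of_eq H.posB (fun i j => birationalPromote_pos H _ i j rfl) fun i j h => by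
    rw [birationalPromote, if_neg h]

theorem isBirationalPromotion_iterate {z : ℤ → ℤ → ℝ} (H : IsWeightArray a b B z) :
    IsBirationalPromotion a b B fun l => (birationalPromote a b B)^[l] z := by
  have hl : ∀ l, IsWeightArray a b B ((birationalPromote a b B)^[l] z) := by
    intro l
    induction l with
    | zero => exact H
    | succ l ih =>
      rw [Function.iterate_succ_apply']
      exact isWeightArray_birationalPromote ih
  refine ⟨hl, fun l i j hi hia hj hjb => ?_⟩
  have h1 := ((hl l).pos i j hi hia hj hjb).ne'
  have h2 := ((hl l).inv_add_inv_pos i j hi hia hj hjb).ne'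
  simp only [Function.iterate_succ_apply']
  rw [birationalPromote, if_pos ⟨hi, hia, hj, hjb⟩, mul_assoc, div_mul_cancel₀]
  exact mul_ne_zero h1 h2

end Promote

/-- `F` grows like the `p`-th power. -/
def GrowsLike (F : ℝ → ℝ) (p : ℤ) : Prop :=
  ∃ k K : ℝ, 0 < k ∧ 0 < K ∧ ∀ M : ℝ, 1 ≤ M → k * M ^ p ≤ F M ∧ F M ≤ K * M ^ p

namespace GrowsLike

variable {F G : ℝ → ℝ} {p q : ℤ}

theorem congr (h : GrowsLike F p) (hFG : ∀ M, 1 ≤ M → G M = F M) : GrowsLike G p := by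
  obtain ⟨k, K, hk, hK, h⟩ := h
  exact ⟨k, K, hk, hK, fun M hM => by rw [hFG M hM]; exact h M hM⟩

theorem zpow (p : ℤ) : GrowsLike (fun M => M ^ p) p :=
  ⟨1, 1, one_pos, one_pos, fun M _ => by simp⟩

theorem pos (h : GrowsLike F p) {M : ℝ} (hM : 1 ≤ M) : 0 < F M := by
  obtain ⟨k, K, hk, hK, h⟩ := h
  have : (0 : ℝ) < M := by linarith
  exact lt_of_lt_of_le (by positivity) (h M hM).1

theorem mul (hF : GrowsLike F p) (hG : GrowsLike G q) :
    GrowsLike (fun M => F M * G M) (p + q) := by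
  have pF := fun M => hF.pos (M := M)
  have pG := fun M => hG.pos (M := M)
  obtain ⟨k, K, hk, hK, h⟩ := hF
  obtain ⟨k', K', hk', hK', h'⟩ := hG
  refine ⟨k * k', K * K', by positivity, by positivity, fun M hM => ?_⟩
  have hM0 : (0 : ℝ) < M := by linarith
  rw [zpow_add₀ hM0.ne']
  constructor
  · calc k * k' * (M ^ p * M ^ q) = (k * M ^ p) * (k' * M ^ q) := by ring
      _ ≤ F M * G M := mul_le_mul (h M hM).1 (h' M hM).1 (by positivity) (pF M hM).le
  · calc F M * G M ≤ (K * M ^ p) * (K' * M ^ q) :=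
          mul_le_mul (h M hM).2 (h' M hM).2 (pG M hM).le (by positivity)
      _ = K * K' * (M ^ p * M ^ q) := by ring

theorem inv (hF : GrowsLike F p) : GrowsLike (fun M => (F M)⁻¹) (-p) := by
  have pF := fun M => hF.pos (M := M)
  obtain ⟨k, K, hk, hK, h⟩ := hF
  refine ⟨K⁻¹, k⁻¹, by positivity, by positivity, fun M hM => ?_⟩
  have hM0 : (0 : ℝ) < M := by linarith
  rw [zpow_neg, ← mul_inv, ← mul_inv]
  exact ⟨inv_anti₀ (pF M hM) (h M hM).2, inv_anti₀ (by positivity) (h M hM).1⟩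

theorem add (hF : GrowsLike F p) (hG : GrowsLike G q) :
    GrowsLike (fun M => F M + G M) (max p q) := by
  have pF := fun M => hF.pos (M := M)
  have pG := fun M => hG.pos (M := M)
  obtain ⟨k, K, hk, hK, h⟩ := hF
  obtain ⟨k', K', hk', hK', h'⟩ := hG
  refine ⟨min k k', K + K', by positivity, by positivity, fun M hM => ⟨?_, ?_⟩⟩
  · have hM0 : (0 : ℝ) < M := by linarith
    rcases max_cases p q with ⟨e, _⟩ | ⟨e, _⟩ <;> rw [e]
    · have : min k k' * M ^ p ≤ k * M ^ p := by gcongr; exact min_le_left _ _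
      linarith [(h M hM).1, pG M hM]
    · have : min k k' * M ^ q ≤ k' * M ^ q := by gcongr; exact min_le_right _ _
      linarith [(h' M hM).1, pF M hM]
  · have h1 : M ^ p ≤ M ^ max p q := zpow_le_zpow_right₀ hM (le_max_left _ _)
    have h2 : M ^ q ≤ M ^ max p q := zpow_le_zpow_right₀ hM (le_max_right _ _)
    calc F M + G M ≤ K * M ^ p + K' * M ^ q := add_le_add (h M hM).2 (h' M hM).2
      _ ≤ K * M ^ max p q + K' * M ^ max p q := by gcongr
      _ = (K + K') * M ^ max p q := by ring

theorem le (hF : GrowsLike F p) (hG : GrowsLike F q) : p ≤ q := by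
  obtain ⟨k, K, hk, hK, h⟩ := hF
  obtain ⟨k', K', hk', hK', h'⟩ := hG
  by_contra! hpq
  have hM : 1 ≤ K' / k + 1 := by
    have : 0 < K' / k := by positivity
    linarith
  have hM0 : 0 < K' / k + 1 := by linarith
  set M := K' / k + 1 with hMdef
  have h1 := (h M hM).1.trans (h' M hM).2
  have h2 : M ^ (q + 1) ≤ M ^ p := zpow_le_zpow_right₀ hM hpq
  rw [zpow_add_one₀ hM0.ne'] at h2
  have h3 : 0 < M ^ q := by positivity
  have h4 : k * M * M ^ q ≤ K' * M ^ q := by nlinarith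
  have h5 := le_of_mul_le_mul_right h4 h3
  have h6 : k * M = K' + k := by rw [hMdef]; field_simp
  linarith

theorem unique (hF : GrowsLike F p) (hG : GrowsLike F q) : p = q :=
  le_antisymm (hF.le hG) (hG.le hF)

end GrowsLike

section Evacuation

variable (a b c : ℕ)

/-- The successive partial sweeps computing the evacuation of `h`. -/
noncomputable def promotionOrbit (h : {h // IsHeightFn a b c h}) : ℕ → {h // IsHeightFn a b c h}
  | 0 => h
  | l + 1 => sweep (antidiagToggle a b c) (a + b - 1 - l) (promotionOrbit h l)

theorem evacuation_eq_promotionOrbit (h : {h // IsHeightFn a b c h}) (m : ℕ) (hm : m ≤ a + b - 1) :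
    evacuation (antidiagToggle a b c) m (promotionOrbit a b c h (a + b - 1 - m)) =
      promotionOrbit a b c h (a + b - 1) := by
  induction m with
  | zero => rfl
  | succ m ih =>
    rw [evacuation, Equiv.Perm.mul_apply, ← ih (by lia)]
    congr 1
    rw [show a + b - 1 - m = a + b - 1 - (m + 1) + 1 by lia, promotionOrbit,
      show a + b - 1 - (a + b - 1 - (m + 1)) = m + 1 by lia]

theorem promotionOrbit_eq_of_le (h : {h // IsHeightFn a b c h}) (i j l m : ℕ)
    (hi : i < a) (hj : j < b) (hl : i + j + 1 ≤ l) (hlm : l ≤ m) :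
    (promotionOrbit a b c h m).1 i j = (promotionOrbit a b c h l).1 i j := by
  induction m, hlm using Nat.le_induction with
  | base => rfl
  | succ m hm ih =>
    rw [promotionOrbit, sweep_antidiagToggle_of_not, ih]
    lia

/-- The weight arrays `M ^ h` and their birational promotions. -/
noncomputable def weightOrbit (h : ℤ → ℤ → ℤ) (l : ℕ) (M : ℝ) : ℤ → ℤ → ℝ :=
  (birationalPromote a b (M ^ c))^[l] fun i j =>
    if 0 ≤ i ∧ i < a ∧ 0 ≤ j ∧ j < b then M ^ h i j else weightBoundary a b (M ^ c) i j

theorem isBirationalPromotion_weightOrbit (h : ℤ → ℤ → ℤ) (M : ℝ) (hM : 0 < M) :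
    IsBirationalPromotion a b (M ^ c) fun l => weightOrbit a b c h l M := by
  refine isBirationalPromotion_iterate (isWeightArray_of_eq (by positivity) ?_ ?_)
  · intro i j hi hia hj hjb
    rw [if_pos ⟨hi, hia, hj, hjb⟩]
    positivity
  · intro i j hij
    rw [if_neg hij]

theorem growsLike_weightOrbit (h : {h // IsHeightFn a b c h}) (l : ℕ) (i j : ℤ) (hi : 0 ≤ i)
    (hia : i < a) (hj : 0 ≤ j) (hjb : j < b) (hl : l ≤ i + j + 1) :
    GrowsLike (fun M => weightOrbit a b c h.1 l M i j) ((promotionOrbit a b c h l).1 i j) := by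
  induction l generalizing i j with
  | zero =>
    refine (GrowsLike.zpow _).congr fun M _ => ?_
    simp only [weightOrbit, Function.iterate_zero, id_eq, promotionOrbit]
    rw [if_pos ⟨hi, hia, hj, hjb⟩]
  | succ l ih =>
    generalize hn : (a + b - i - j).toNat = n
    induction n using Nat.strong_induction_on generalizing i j with
    | _ n ih2 =>
    set f := promotionOrbit a b c h l with hf
    set g := promotionOrbit a b c h (l + 1) with hg
    push_cast at hl
    have hB : ∀ M : ℝ, 1 ≤ M → IsBirationalPromotion a b (M ^ c)
        fun l => weightOrbit a b c h.1 l M := fun M hM =>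
      isBirationalPromotion_weightOrbit a b c h.1 M (by linarith)
    have lower : GrowsLike (fun M => weightOrbit a b c h.1 (l + 1) M (i + 1) j +
        weightOrbit a b c h.1 (l + 1) M i (j + 1)) (max (g.1 (i + 1) j) (g.1 i (j + 1))) := by
      by_cases h1 : i + 1 < a
      · have t1 := ih2 _ (by lia) (i + 1) j (by lia) h1 hj hjb (by push_cast; lia) rfl
        by_cases h2 : j + 1 < b
        · have t2 := ih2 _ (by lia) i (j + 1) hi hia (by lia) h2 (by push_cast; lia) rfl
          exact t1.add t2
        · rw [g.2.bot i (j + 1) hi (by lia) (by lia), max_eq_left (g.2.nonneg _ _)]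
          refine t1.congr fun M hM => ?_
          rw [(hB M hM).outside (l + 1) i (j + 1) (by lia) (by lia) (by lia), add_zero]
      · rw [g.2.bot (i + 1) j (by lia) (by lia) (by lia)]
        by_cases h2 : j + 1 < b
        · have t2 := ih2 _ (by lia) i (j + 1) hi hia (by lia) h2 (by push_cast; lia) rfl
          rw [max_eq_right (g.2.nonneg _ _)]
          refine t2.congr fun M hM => ?_
          rw [(hB M hM).outside (l + 1) (i + 1) j (by lia) (by lia) (by lia), zero_add]
        · rw [g.2.bot i (j + 1) hi (by lia) (by lia), max_self]
          refine (GrowsLike.zpow 0).congr fun M hM => ?_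
          rw [(hB M hM).outside (l + 1) i (j + 1) (by lia) (by lia) (by lia),
            show i + 1 = a by lia, show j = b - 1 by lia, (hB M hM).corner (l + 1)]
          simp
    have upper : GrowsLike (fun M => (weightOrbit a b c h.1 l M (i - 1) j)⁻¹ +
        (weightOrbit a b c h.1 l M i (j - 1))⁻¹) (-min (f.1 (i - 1) j) (f.1 i (j - 1))) := by
      rw [← max_neg_neg]
      by_cases h1 : 0 ≤ i - 1
      · have t1 := (ih (i - 1) j h1 (by lia) hj hjb (by lia)).inv
        by_cases h2 : 0 ≤ j - 1
        · have t2 := (ih i (j - 1) hi hia h2 (by lia) (by lia)).inv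
          exact t1.add t2
        · rw [f.2.top i (j - 1) (by lia), max_eq_left (neg_le_neg (f.2.le_top _ _))]
          refine t1.congr fun M hM => ?_
          rw [(hB M hM).outside l i (j - 1) (by lia) (by lia) (by lia), inv_zero, add_zero]
      · rw [f.2.top (i - 1) j (by lia)]
        by_cases h2 : 0 ≤ j - 1
        · have t2 := (ih i (j - 1) hi hia h2 (by lia) (by lia)).inv
          rw [max_eq_right (neg_le_neg (f.2.le_top _ _))]
          refine t2.congr fun M hM => ?_
          rw [(hB M hM).outside l (i - 1) j (by lia) (by lia) (by lia), inv_zero, zero_add]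
        · rw [f.2.top i (j - 1) (by lia), max_self]
          refine (GrowsLike.zpow (-c)).congr fun M hM => ?_
          rw [(hB M hM).outside l i (j - 1) (by lia) (by lia) (by lia),
            show i - 1 = -1 by lia, show j = 0 by lia, (hB M hM).source l]
          simp
    have hmid := ih i j hi hia hj hjb (by lia)
    have hrec : g.1 i j = max (g.1 (i + 1) j) (g.1 i (j + 1)) +
        -(f.1 i j + -min (f.1 (i - 1) j) (f.1 i (j - 1))) := by
      have := sweep_antidiagToggle a b c (a + b - 1 - l) f i j ⟨hi, hia, hj, hjb⟩ (by lia)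
      rw [hg, promotionOrbit, ← hf]
      lia
    rw [hrec]
    refine (lower.mul (hmid.mul upper).inv).congr fun M hM => ?_
    have p := (hB M hM).promote l i j hi hia hj hjb
    have p1 := (hmid.pos hM).ne'
    have p2 := (upper.pos hM).ne'
    beta_reduce at p
    rw [eq_comm, ← div_eq_mul_inv, div_eq_iff (mul_ne_zero p1 p2), ← p, mul_assoc]

theorem evacuation_antidiagToggle (h : {h // IsHeightFn a b c h}) (i j : ℕ) (hi : i < a)
    (hj : j < b) :
    (evacuation (antidiagToggle a b c) (a + b - 1) h).1 i j + h.1 (a - 1 - i) (b - 1 - j) = c := by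
  have e := evacuation_eq_promotionOrbit a b c h (a + b - 1) le_rfl
  rw [Nat.sub_self, promotionOrbit] at e
  rw [e, promotionOrbit_eq_of_le a b c h i j (i + j + 1) _ hi hj le_rfl (by lia)]
  have t1 := growsLike_weightOrbit a b c h (i + j + 1) i j (by lia) (by lia) (by lia) (by lia)
    (by push_cast; lia)
  have t2 := growsLike_weightOrbit a b c h 0 (a - 1 - i) (b - 1 - j) (by lia) (by lia) (by lia)
    (by lia) (by push_cast; lia)
  refine ((t1.mul t2).congr fun M hM => ?_).unique (GrowsLike.zpow c)
  have := (isBirationalPromotion_weightOrbit a b c h.1 M (by linarith)).reciprocity 0 i j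
    (by lia) (by lia)
  simp only [zero_add] at this
  rw [this, zpow_natCast]

end Evacuation

theorem IsHeightFn.ext {a b c : ℕ} {g h : ℤ → ℤ → ℤ} (hg : IsHeightFn a b c g)
    (hh : IsHeightFn a b c h)
    (hgh : ∀ i j : ℤ, 0 ≤ i → i < a → 0 ≤ j → j < b → g i j = h i j) : g = h := by
  funext i j
  by_cases h1 : i < 0 ∨ j < 0
  · rw [hg.top i j h1, hh.top i j h1]
  by_cases h2 : a ≤ i ∨ b ≤ j
  · rw [hg.bot i j (by lia) (by lia) h2, hh.bot i j (by lia) (by lia) h2]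
  exact hgh i j (by lia) (by lia) (by lia) (by lia)

/-- The cells of the `a × b` rectangle with even coordinate sum. -/
def evenCell (a b : ℕ) (i j : ℤ) : Prop := (0 ≤ i ∧ i < a ∧ 0 ≤ j ∧ j < b) ∧ Even (i + j)

theorem evenCell_notAdjacent (a b : ℕ) : NotAdjacent (evenCell a b) (evenCell a b) := by
  intro i j hij
  have := hij.2
  refine ⟨?_, ?_, ?_, ?_⟩ <;> intro h <;> have := h.2 <;> grind

theorem card_rotationFixed_eq_card_toggleFixed (a b c : ℕ) :
    Nat.card {h : {h // IsHeightFn a b c h} //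
      ∀ i j : ℕ, i < a → j < b → h.1 i j + h.1 (a - 1 - i) (b - 1 - j) = c} =
    Nat.card {h : {h // IsHeightFn a b c h} // toggle (evenCell a b) h.1 = h.1} := by
  obtain ⟨g, -, hg⟩ := exists_conj_evacuation_alternate (antidiagToggle_mul_self a b c)
    (fun k l hkl => antidiagToggle_commute a b c k l hkl) (a + b - 1)
  refine Nat.card_congr (g.subtypeEquiv fun h => ?_)
  have halt : (alternate (antidiagToggle a b c) (a + b - 1) (g h)).1 =
      toggle (evenCell a b) (g h).1 := by
    rw [alternate_antidiagToggle]
    congr 1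
    funext i j
    apply propext
    constructor
    · rintro ⟨k, hk, ho, h1, h2⟩
      exact ⟨h1, by grind⟩
    · rintro ⟨h1, h2⟩
      exact ⟨(a + b - 2 - i - j).toNat, by lia, by grind, h1, by lia⟩
  have hev : (evacuation (antidiagToggle a b c) (a + b - 1) h = h) ↔
      ∀ i j : ℕ, i < a → j < b → h.1 i j + h.1 (a - 1 - i) (b - 1 - j) = c := by
    constructor
    · intro e i j hi hj
      have := evacuation_antidiagToggle a b c h i j hi hj
      rwa [e] at this
    · intro e
      refine Subtype.ext (IsHeightFn.ext (Subtype.property _) h.2 fun i j hi hia hj hjb => ?_)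
      lift i to ℕ using hi
      lift j to ℕ using hj
      have h1 := evacuation_antidiagToggle a b c h i j (by lia) (by lia)
      have h2 := e i j (by lia) (by lia)
      lia
  rw [← hev, ← halt, ← hg]
  rw [Subtype.val_inj, ← Equiv.Perm.mul_apply, inv_mul_cancel_right, Equiv.Perm.mul_apply,
    g.apply_eq_iff_eq]

/-- At the even cell `(i, j)`, the height is maximal and of the parity of its least possible
value. -/
def IsParityMaximal (h : ℤ → ℤ → ℤ) (i j : ℤ) : Prop :=
  h i j = min (h (i - 1) j) (h i (j - 1)) ∧
    Even (min (h (i - 1) j) (h i (j - 1)) - max (h (i + 1) j) (h i (j + 1)))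

open Classical in
theorem card_toggleFixed_eq_card_parityMaximal (a b c : ℕ) :
    Nat.card {h : {h // IsHeightFn a b c h} // toggle (evenCell a b) h.1 = h.1} =
    Nat.card {h : {h // IsHeightFn a b c h} //
      ∀ i j, evenCell a b i j → IsParityMaximal h.1 i j} := by
  have adj := evenCell_notAdjacent a b
  have anti : ∀ h : {h // IsHeightFn a b c h}, ∀ i j,
      max (h.1 (i + 1) j) (h.1 i (j + 1)) ≤ min (h.1 (i - 1) j) (h.1 i (j - 1)) := by
    intro h i j
    have h1 := h.2.anti_left i j
    have h2 := h.2.anti_right i j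
    have h3 := h.2.anti_left (i - 1) j
    have h4 := h.2.anti_right i (j - 1)
    rw [sub_add_cancel] at h3 h4
    lia
  let raise (h : {h // IsHeightFn a b c h}) : {h // IsHeightFn a b c h} :=
    ⟨fun i j => if evenCell a b i j then min (h.1 (i - 1) j) (h.1 i (j - 1)) else h.1 i j,
      h.2.modify adj (fun _ _ hij => hij.1) (fun _ _ hij => if_neg hij) fun i j hij => by
        rw [if_pos hij]; exact ⟨anti h i j, le_rfl⟩⟩
  let middle (h : {h // IsHeightFn a b c h}) : {h // IsHeightFn a b c h} :=
    ⟨fun i j => if evenCell a b i j then (max (h.1 (i + 1) j) (h.1 i (j + 1)) +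
        min (h.1 (i - 1) j) (h.1 i (j - 1))) / 2 else h.1 i j,
      h.2.modify adj (fun _ _ hij => hij.1) (fun _ _ hij => if_neg hij) fun i j hij => by
        have := anti h i j
        rw [if_pos hij]; constructor <;> lia⟩
  have fixed : ∀ h : {h // IsHeightFn a b c h}, toggle (evenCell a b) h.1 = h.1 ↔
      ∀ i j, evenCell a b i j → max (h.1 (i + 1) j) (h.1 i (j + 1)) +
        min (h.1 (i - 1) j) (h.1 i (j - 1)) = 2 * h.1 i j := by
    intro h
    constructor
    · intro e i j hij
      have := congr_fun (congr_fun e i) j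
      rw [toggle, if_pos hij] at this
      lia
    · intro e
      funext i j
      by_cases hij : evenCell a b i j
      · have := e i j hij
        rw [toggle, if_pos hij]
        lia
      · rw [toggle, if_neg hij]
  refine Nat.card_congr ⟨fun h => ⟨raise h.1, fun i j hij => ?_⟩,
    fun h => ⟨middle h.1, (fixed _).2 fun i j hij => ?_⟩, fun h => ?_, fun h => ?_⟩
  · obtain ⟨h1, h2, h3, h4⟩ := adj i j hij
    have := (fixed h.1).1 h.2 i j hij
    simp only [raise, IsParityMaximal, if_pos hij, if_neg h1, if_neg h2, if_neg h3, if_neg h4]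
    refine ⟨trivial, ?_⟩
    grind
  · obtain ⟨h1, h2, h3, h4⟩ := adj i j hij
    have := (h.2 i j hij).2
    simp only [middle, if_pos hij, if_neg h1, if_neg h2, if_neg h3, if_neg h4]
    grind
  · apply Subtype.ext
    apply Subtype.ext
    funext i j
    by_cases hij : evenCell a b i j
    · obtain ⟨h1, h2, h3, h4⟩ := adj i j hij
      have := (fixed h.1).1 h.2 i j hij
      simp only [raise, middle, if_pos hij, if_neg h1, if_neg h2, if_neg h3, if_neg h4]
      lia
    · simp only [raise, middle, if_neg hij]
  · apply Subtype.ext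
    apply Subtype.ext
    funext i j
    by_cases hij : evenCell a b i j
    · obtain ⟨h1, h2, h3, h4⟩ := adj i j hij
      have := (h.2 i j hij).1
      simp only [raise, middle, if_pos hij, if_neg h3, if_neg h4]
      exact this.symm
    · simp only [raise, middle, if_neg hij]

/-- The sign of a height function. -/
def heightSign (a b : ℕ) (h : ℤ → ℤ → ℤ) : ℤ :=
  ∏ p ∈ range a ×ˢ range b, ((h p.1 p.2).negOnePow : ℤ)

theorem heightSign_of_parityMaximal {a b c : ℕ} {h : ℤ → ℤ → ℤ} (H : IsHeightFn a b c h)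
    (hmax : ∀ i j, evenCell a b i j → IsParityMaximal h i j) : heightSign a b h = 1 := by
  have hdouble : ∀ (n : ℕ) (f : ℕ → ℤ),
      ∏ i ∈ range (2 * n), f i = ∏ i ∈ range n, f (2 * i) * f (2 * i + 1) := by
    intro n f
    induction n with
    | zero => rfl
    | succ n ih =>
      rw [mul_add, mul_one, prod_range_succ, prod_range_succ, ih, prod_range_succ, mul_assoc]
  have hext : ∏ p ∈ range (2 * a) ×ˢ range (2 * b), ((h p.1 p.2).negOnePow : ℤ) =
      heightSign a b h := by
    refine (prod_subset (product_subset_product ?_ ?_) ?_).symm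
    · exact range_subset_range.2 (by lia)
    · exact range_subset_range.2 (by lia)
    · intro p _ hp
      rw [H.bot p.1 p.2 (by lia) (by lia)]
      · simp
      · simp only [mem_product, mem_range] at hp
        lia
  rw [← hext, prod_product, hdouble]
  refine prod_eq_one fun p _ => ?_
  rw [← prod_mul_distrib, hdouble]
  refine prod_eq_one fun q _ => ?_
  push_cast
  rw [← Units.val_mul, ← Units.val_mul, ← Units.val_mul, ← Int.negOnePow_add, ← Int.negOnePow_add,
    ← Int.negOnePow_add, Int.negOnePow_even, Units.val_one]
  have h1 : Even (h (2 * p) (2 * q) - max (h (2 * p + 1) (2 * q)) (h (2 * p) (2 * q + 1))) := by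
    by_cases hin : (2 * p : ℤ) < a ∧ (2 * q : ℤ) < b
    · have := hmax (2 * p) (2 * q) ⟨by lia, by grind⟩
      rw [this.1]
      exact this.2
    · rw [H.bot _ _ (by lia) (by lia) (by lia), H.bot _ _ (by lia) (by lia) (by lia),
        H.bot _ _ (by lia) (by lia) (by lia)]
      simp
  have h2 : h (2 * p + 1) (2 * q + 1) = min (h (2 * p) (2 * q + 1)) (h (2 * p + 1) (2 * q)) := by
    by_cases hin : (2 * p + 1 : ℤ) < a ∧ (2 * q + 1 : ℤ) < b
    · have := (hmax (2 * p + 1) (2 * q + 1) ⟨by lia, by grind⟩).1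
      rw [add_sub_cancel_right, add_sub_cancel_right] at this
      exact this
    · rw [H.bot _ _ (by lia) (by lia) (by lia)]
      have n1 := H.nonneg (2 * p) (2 * q + 1)
      have n2 := H.nonneg (2 * p + 1) (2 * q)
      by_cases hp : (a : ℤ) ≤ 2 * p + 1
      · have := H.bot (2 * p + 1) (2 * q) (by lia) (by lia) (by lia)
        lia
      · have := H.bot (2 * p) (2 * q + 1) (by lia) (by lia) (by lia)
        lia
  grind

theorem heightSign_neg {a b : ℕ} {g h : ℤ → ℤ → ℤ} {i j : ℤ}
    (hin : 0 ≤ i ∧ i < a ∧ 0 ≤ j ∧ j < b)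
    (hne : ∀ i' j', ¬ (i' = i ∧ j' = j) → g i' j' = h i' j') (hodd : Odd (g i j - h i j)) :
    heightSign a b g = -heightSign a b h := by
  lift i to ℕ using hin.1
  lift j to ℕ using hin.2.2.1
  have hmem : (i, j) ∈ range a ×ˢ range b := by
    simp only [mem_product, mem_range]; lia
  unfold heightSign
  rw [← mul_prod_erase _ _ hmem, ← mul_prod_erase _ _ hmem, ← neg_mul]
  congr 1
  · have : g i j = h i j + (g i j - h i j) := by ring
    simp only
    rw [this, Int.negOnePow_add, Int.negOnePow_odd _ hodd]
    simp
  · refine prod_congr rfl fun p hp => ?_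
    rw [mem_erase] at hp
    rw [hne]
    intro h'
    exact hp.1 (Prod.ext (by lia) (by lia))

open Classical in
theorem sum_heightSign (a b c : ℕ) [Fintype {h // IsHeightFn a b c h}] :
    ∑ h : {h // IsHeightFn a b c h}, heightSign a b h.1 =
      Nat.card {h : {h // IsHeightFn a b c h} //
        ∀ i j, evenCell a b i j → IsParityMaximal h.1 i j} := by
  have adj := evenCell_notAdjacent a b
  let bad (h : {h // IsHeightFn a b c h}) (p : ℤ × ℤ) : Prop :=
    evenCell a b p.1 p.2 ∧ ¬ IsParityMaximal h.1 p.1 p.2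
  let cell (h : {h // IsHeightFn a b c h}) : ℤ × ℤ := Classical.epsilon (bad h)
  have cell_spec : ∀ h : {h // IsHeightFn a b c h},
      ¬ (∀ i j, evenCell a b i j → IsParityMaximal h.1 i j) → bad h (cell h) := by
    intro h hh
    push Not at hh
    obtain ⟨i, j, h1, h2⟩ := hh
    exact Classical.epsilon_spec (p := bad h) ⟨(i, j), h1, h2⟩
  let bump (h : {h // IsHeightFn a b c h}) (p : ℤ × ℤ) (i j : ℤ) : ℤ :=
    if i = p.1 ∧ j = p.2 then
      if Even (h.1 i j - max (h.1 (i + 1) j) (h.1 i (j + 1))) then h.1 i j + 1 else h.1 i j - 1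
    else h.1 i j
  have bump_isHeightFn : ∀ h p, bad h p → IsHeightFn a b c (bump h p) := by
    rintro h ⟨i, j⟩ ⟨he, hp⟩
    refine h.2.modify (S := fun i' j' => i' = i ∧ j' = j) ?_ ?_
      (fun _ _ hij => if_neg hij) ?_
    · rintro i' j' ⟨rfl, rfl⟩
      refine ⟨?_, ?_, ?_, ?_⟩ <;> lia
    · rintro i' j' ⟨rfl, rfl⟩
      exact he.1
    · rintro i' j' ⟨rfl, rfl⟩
      have h1 := h.2.anti_left i' j'
      have h2 := h.2.anti_right i' j'
      have h3 := h.2.anti_left (i' - 1) j'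
      have h4 := h.2.anti_right i' (j' - 1)
      rw [sub_add_cancel] at h3 h4
      simp only [bump, IsParityMaximal] at hp ⊢
      rw [if_pos ⟨trivial, trivial⟩]
      split_ifs with hev
      · refine ⟨by lia, ?_⟩
        by_contra hlt
        have heq : h.1 i' j' = min (h.1 (i' - 1) j') (h.1 i' (j' - 1)) := by lia
        exact hp ⟨heq, heq ▸ hev⟩
      · refine ⟨?_, by lia⟩
        by_contra hlt
        have heq : h.1 i' j' = max (h.1 (i' + 1) j') (h.1 i' (j' + 1)) := by lia
        exact hev (by rw [← heq, sub_self]; exact Even.zero)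
  have bump_nbr : ∀ h p, evenCell a b p.1 p.2 → ∀ i j, ¬ evenCell a b i j →
      bump h p i j = h.1 i j := by
    intro h p hp i j hij
    refine if_neg ?_
    rintro ⟨rfl, rfl⟩
    exact hij hp
  have bump_bad : ∀ h p (hp : bad h p) q, bad ⟨bump h p, bump_isHeightFn h p hp⟩ q ↔ bad h q := by
    rintro h p hp ⟨i, j⟩
    refine and_congr_right fun hij => not_congr ?_
    obtain ⟨h1, h2, h3, h4⟩ := adj i j hij
    simp only [IsParityMaximal, bump_nbr h p hp.1 _ _ h1, bump_nbr h p hp.1 _ _ h2,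
      bump_nbr h p hp.1 _ _ h3, bump_nbr h p hp.1 _ _ h4]
    by_cases hpq : i = p.1 ∧ j = p.2
    · obtain ⟨rfl, rfl⟩ := hpq
      have hp2 := hp.2
      simp only [IsParityMaximal] at hp2
      simp only [hp2, iff_false]
      rintro ⟨e1, e2⟩
      have n3 := h.2.anti_left (p.1 - 1) p.2
      have n4 := h.2.anti_right p.1 (p.2 - 1)
      rw [sub_add_cancel] at n3 n4
      simp only [bump, and_self, if_true] at e1
      split_ifs at e1 with hev
      · rw [← e1] at e2
        grind
      · lia
    · simp only [bump, if_neg hpq]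
  let flip (h : {h // IsHeightFn a b c h}) : {h // IsHeightFn a b c h} :=
    if hb : bad h (cell h) then ⟨bump h (cell h), bump_isHeightFn h _ hb⟩ else h
  have cell_flip : ∀ h, cell (flip h) = cell h := by
    intro h
    by_cases hb : bad h (cell h)
    · simp only [flip, dif_pos hb, cell]
      congr 1
      funext q
      exact propext (bump_bad h _ hb q)
    · simp only [flip, dif_neg hb]
  rw [← sum_filter_add_sum_filter_not univ
    (fun h : {h // IsHeightFn a b c h} => ∀ i j, evenCell a b i j → IsParityMaximal h.1 i j)]
  have hgood : ∑ h : {h // IsHeightFn a b c h} with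
      ∀ i j, evenCell a b i j → IsParityMaximal h.1 i j, heightSign a b h.1 =
      Nat.card {h : {h // IsHeightFn a b c h} //
        ∀ i j, evenCell a b i j → IsParityMaximal h.1 i j} := by
    rw [sum_congr rfl fun h hh => heightSign_of_parityMaximal h.2 (mem_filter.1 hh).2, sum_const,
      Nat.card_eq_fintype_card, Fintype.card_subtype]
    simp
  rw [hgood, add_eq_left]
  have flip_val : ∀ h, ¬ (∀ i j, evenCell a b i j → IsParityMaximal h.1 i j) →
      (flip h).1 = bump h (cell h) := by
    intro h hh
    simp only [flip, dif_pos (cell_spec h hh)]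
  have bump_odd : ∀ h p, Odd (bump h p p.1 p.2 - h.1 p.1 p.2) := by
    intro h p
    simp only [bump, and_self, if_true]
    split_ifs <;> grind
  have flip_bad : ∀ h, ¬ (∀ i j, evenCell a b i j → IsParityMaximal h.1 i j) →
      ¬ (∀ i j, evenCell a b i j → IsParityMaximal (flip h).1 i j) := by
    intro h hh hf
    have hb := cell_spec h hh
    have := (bump_bad h _ hb (cell h)).2 hb
    rw [show (⟨bump h (cell h), bump_isHeightFn h _ hb⟩ : {h // IsHeightFn a b c h}) = flip h from
      Subtype.ext (flip_val h hh).symm] at this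
    exact this.2 (hf _ _ this.1)
  refine sum_involution (fun h _ => flip h) ?_ ?_ ?_ ?_
  · intro h hh
    have hh := (mem_filter.1 hh).2
    rw [flip_val h hh, heightSign_neg (g := bump h (cell h)) (cell_spec h hh).1.1
      (fun i j hij => if_neg hij) (bump_odd h _), add_neg_cancel]
  · intro h hh _ heq
    have hh := (mem_filter.1 hh).2
    have := bump_odd h (cell h)
    rw [← flip_val h hh, heq, sub_self] at this
    exact absurd this (by decide)
  · intro h hh
    exact mem_filter.2 ⟨mem_univ _, flip_bad h (mem_filter.1 hh).2⟩
  · intro h hh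
    have hh := (mem_filter.1 hh).2
    apply Subtype.ext
    rw [flip_val _ (flip_bad h hh), cell_flip]
    have hb := cell_spec h hh
    obtain ⟨n1, n2, -, -⟩ := adj _ _ hb.1
    funext i j
    by_cases hij : i = (cell h).1 ∧ j = (cell h).2
    · obtain ⟨rfl, rfl⟩ := hij
      have e1 := bump_nbr h _ hb.1 _ _ n1
      have e2 := bump_nbr h _ hb.1 _ _ n2
      have e3 : bump h (cell h) (cell h).1 (cell h).2 = _ := if_pos ⟨rfl, rfl⟩
      rw [← flip_val h hh] at e1 e2 e3
      refine (if_pos ⟨rfl, rfl⟩).trans ?_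
      rw [e1, e2, e3]
      clear e1 e2 e3
      split_ifs <;> grind
    · simp only [bump, if_neg hij, flip_val h hh]

section PlanePartition

variable {a b c : ℕ}

theorem Fin.mem_iff_lt_card_of_isLowerSet {n : ℕ} {D : Finset (Fin n)}
    (hD : ∀ k ∈ D, ∀ l ≤ k, l ∈ D) (k : Fin n) : k ∈ D ↔ (k : ℕ) < D.card := by
  constructor
  · intro hk
    have := card_le_card (show Iic k ⊆ D from fun l hl => hD k hk l (mem_Iic.1 hl))
    rwa [Fin.card_Iic] at this
  · contrapose!
    intro hk
    have := card_le_card (show D ⊆ Iio k from fun l hl => mem_Iio.2 <| by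
      by_contra h
      exact hk (hD l hl k (not_lt.1 h)))
    rwa [Fin.card_Iio] at this

/-- The height of the column of `T` over each cell, extended as in `IsHeightFn`. -/
noncomputable def columnHeight (T : Finset (Fin a × Fin b × Fin c)) (i j : ℤ) : ℤ :=
  if i < 0 ∨ j < 0 then c
  else (univ.filter fun k : Fin c =>
    ∃ p ∈ T, ((p.1 : ℕ) : ℤ) = i ∧ ((p.2.1 : ℕ) : ℤ) = j ∧ p.2.2 = k).card

theorem columnHeight_cell (T : Finset (Fin a × Fin b × Fin c)) (i : Fin a) (j : Fin b) :
    columnHeight T (i : ℕ) (j : ℕ) = (univ.filter fun k : Fin c => (i, j, k) ∈ T).card := by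
  rw [columnHeight, if_neg (by omega)]
  congr 2
  ext k
  simp only [mem_filter, mem_univ, true_and]
  constructor
  · rintro ⟨⟨i', j', k'⟩, hp, h1, h2, rfl⟩
    obtain rfl : i' = i := by ext; exact_mod_cast h1
    obtain rfl : j' = j := by ext; exact_mod_cast h2
    exact hp
  · exact fun h => ⟨_, h, rfl, rfl, rfl⟩

theorem columnHeight_le (T : Finset (Fin a × Fin b × Fin c)) (i j : ℤ) :
    columnHeight T i j ≤ c := by
  rw [columnHeight]
  split_ifs
  · rfl
  · exact_mod_cast (card_le_univ _).trans_eq (Fintype.card_fin c)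

theorem IsPP.isHeightFn {T : Finset (Fin a × Fin b × Fin c)} (hT : IsPP a b c T) :
    IsHeightFn a b c (columnHeight T) where
  top i j h := if_pos h
  bot i j hi hj h := by
    rw [columnHeight, if_neg (by omega), Nat.cast_eq_zero, card_eq_zero, filter_eq_empty_iff]
    rintro k - ⟨p, -, h1, h2, -⟩
    omega
  nonneg i j := by
    rw [columnHeight]
    split_ifs <;> positivity
  le_top := columnHeight_le T
  anti_left i j := by
    by_cases h : i < 0 ∨ j < 0
    · exact (columnHeight_le T _ _).trans_eq (if_pos h).symm
    · rw [columnHeight, columnHeight, if_neg h, if_neg (by omega)]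
      refine Nat.cast_le.2 (card_le_card (monotone_filter_right _ fun k _ => ?_))
      rintro ⟨p, hp, h1, h2, h3⟩
      exact ⟨(⟨i.toNat, by omega⟩, p.2), hT p hp _ (Fin.mk_le_of_le_val (by omega)) le_rfl le_rfl,
        by simp only; omega, h2, h3⟩
  anti_right i j := by
    by_cases h : i < 0 ∨ j < 0
    · exact (columnHeight_le T _ _).trans_eq (if_pos h).symm
    · rw [columnHeight, columnHeight, if_neg h, if_neg (by omega)]
      refine Nat.cast_le.2 (card_le_card (monotone_filter_right _ fun k _ => ?_))
      rintro ⟨p, hp, h1, h2, h3⟩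
      exact ⟨(p.1, ⟨j.toNat, by omega⟩, p.2.2),
        hT p hp _ le_rfl (Fin.mk_le_of_le_val (by omega)) le_rfl, h1, by simp only; omega, h3⟩

theorem IsPP.mem_iff {T : Finset (Fin a × Fin b × Fin c)} (hT : IsPP a b c T)
    (p : Fin a × Fin b × Fin c) :
    p ∈ T ↔ ((p.2.2 : ℕ) : ℤ) < columnHeight T (p.1 : ℕ) (p.2.1 : ℕ) := by
  rw [columnHeight_cell, Nat.cast_lt, ← Fin.mem_iff_lt_card_of_isLowerSet]
  · simp
  · intro k hk l hl
    simp only [mem_filter, mem_univ, true_and] at hk ⊢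
    exact hT _ hk _ le_rfl le_rfl hl

theorem IsHeightFn.isPP {h : ℤ → ℤ → ℤ} (H : IsHeightFn a b c h) :
    IsPP a b c (univ.filter fun p => ((p.2.2 : ℕ) : ℤ) < h (p.1 : ℕ) (p.2.1 : ℕ)) := by
  rintro ⟨i, j, k⟩ hp ⟨i', j', k'⟩ h1 h2 h3
  simp only [mem_filter, mem_univ, true_and] at hp h1 h2 h3 ⊢
  have hl : Antitone fun i : ℕ => h i j := antitone_nat_of_succ_le fun n => by
    exact_mod_cast H.anti_left n j
  have hr : Antitone fun j : ℕ => h (i' : ℕ) j := antitone_nat_of_succ_le fun n => by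
    exact_mod_cast H.anti_right (i' : ℕ) n
  have := hl (Fin.le_iff_val_le_val.1 h1)
  have := hr (Fin.le_iff_val_le_val.1 h2)
  have := Fin.le_iff_val_le_val.1 h3
  simp only at *
  omega

theorem eq_of_lt_iff_lt {x y : ℤ} (hx : 0 ≤ x ∧ x ≤ c) (hy : 0 ≤ y ∧ y ≤ c)
    (h : ∀ k : Fin c, ((k : ℕ) : ℤ) < x ↔ ((k : ℕ) : ℤ) < y) : x = y := by
  rcases lt_trichotomy x y with hlt | heq | hlt
  · have := (h ⟨x.toNat, by omega⟩).2 (by simp only; omega)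
    simp only at this
    omega
  · exact heq
  · have := (h ⟨y.toNat, by omega⟩).1 (by simp only; omega)
    simp only at this
    omega

/-- Plane partitions correspond to height functions. -/
noncomputable def planePartitionEquiv (a b c : ℕ) :
    {T // IsPP a b c T} ≃ {h // IsHeightFn a b c h} where
  toFun T := ⟨columnHeight T.1, T.2.isHeightFn⟩
  invFun h := ⟨_, h.2.isPP⟩
  left_inv T := by
    ext p
    simp only [mem_filter, mem_univ, true_and]
    exact (T.2.mem_iff p).symm
  right_inv h := by
    refine Subtype.ext (h.2.isPP.isHeightFn.ext h.2 fun i j hi hia hj hjb => ?_)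
    lift i to ℕ using hi
    lift j to ℕ using hj
    refine eq_of_lt_iff_lt ⟨h.2.isPP.isHeightFn.nonneg _ _, h.2.isPP.isHeightFn.le_top _ _⟩
      ⟨h.2.nonneg _ _, h.2.le_top _ _⟩ fun k => ?_
    have := h.2.isPP.mem_iff (⟨i, by omega⟩, ⟨j, by omega⟩, k)
    simp only [mem_filter, mem_univ, true_and] at this
    exact this.symm

theorem IsPP.ppKappa_eq_iff {T : Finset (Fin a × Fin b × Fin c)} (hT : IsPP a b c T) :
    ppKappa a b c T = T ↔ ∀ i j : ℕ, i < a → j < b →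
      columnHeight T i j + columnHeight T (a - 1 - i) (b - 1 - j) = c := by
  have hrev : ∀ {n : ℕ} (i : Fin n), ((i.rev : ℕ) : ℤ) = n - 1 - (i : ℕ) := by
    intro n i
    rw [Fin.val_rev]
    omega
  have hmem : ∀ p : Fin a × Fin b × Fin c, p ∈ ppKappa a b c T ↔ ((p.2.2 : ℕ) : ℤ) <
      c - columnHeight T (a - 1 - (p.1 : ℕ)) (b - 1 - (p.2.1 : ℕ)) := by
    intro p
    simp only [ppKappa, mem_filter, mem_univ, true_and, hT.mem_iff, hrev]
    omega
  have H := hT.isHeightFn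
  constructor
  · intro e i j hi hj
    have h1 := H.nonneg (a - 1 - i) (b - 1 - j)
    have h2 := H.le_top (a - 1 - i) (b - 1 - j)
    rw [eq_of_lt_iff_lt ⟨H.nonneg i j, H.le_top i j⟩
      (y := c - columnHeight T (a - 1 - i) (b - 1 - j)) (by omega), sub_add_cancel]
    intro k
    rw [← hmem (⟨i, hi⟩, ⟨j, hj⟩, k), e, hT.mem_iff]
  · intro e
    ext p
    rw [hmem, hT.mem_iff, ← e p.1 p.2.1 p.1.2 p.2.1.2, add_sub_cancel_right]

theorem heightSign_columnHeight (T : Finset (Fin a × Fin b × Fin c)) :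
    heightSign a b (columnHeight T) = (-1) ^ T.card := by
  have hcard : T.card = ∑ i : Fin a, ∑ j : Fin b, (univ.filter fun k => (i, j, k) ∈ T).card := by
    rw [show T.card = ∑ p, if p ∈ T then 1 else 0 by simp]
    simp only [Fintype.sum_prod_type, card_filter]
  rw [heightSign, prod_product, prod_range, hcard, ← prod_pow_eq_pow_sum]
  refine prod_congr rfl fun i _ => ?_
  rw [prod_range, ← prod_pow_eq_pow_sum]
  refine prod_congr rfl fun j _ => ?_
  rw [columnHeight_cell, Int.negOnePow_def, zpow_natCast, Units.val_pow_eq_pow_val,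
    Units.coe_neg_one]

end PlanePartition

/-- The number of self-complementary plane partitions in an `a × b × c` box equals
the signed count `∑_T (-1)^{|T|}` over all plane partitions in the box. -/
theorem selfComplementary_count (a b c : ℕ) :
    ((Finset.univ.filter fun T : Finset (Fin a × Fin b × Fin c) =>
        IsPP a b c T ∧ ppKappa a b c T = T).card : ℤ) =
      ∑ T ∈ Finset.univ.filter (IsPP a b c), (-1 : ℤ) ^ T.card := by
  have : Fintype {h // IsHeightFn a b c h} := Fintype.ofEquiv _ (planePartitionEquiv a b c)
  have hsum : ∑ T ∈ univ.filter (IsPP a b c), (-1 : ℤ) ^ T.card =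
      ∑ h : {h // IsHeightFn a b c h}, heightSign a b h.1 := by
    rw [← Equiv.sum_comp (planePartitionEquiv a b c), ← sum_subtype_eq_sum_filter]
    refine sum_congr (by ext; simp) fun T _ => ?_
    exact (heightSign_columnHeight T.1).symm
  have hcard : (univ.filter fun T : Finset (Fin a × Fin b × Fin c) =>
      IsPP a b c T ∧ ppKappa a b c T = T).card =
      Nat.card {h : {h // IsHeightFn a b c h} //
        ∀ i j : ℕ, i < a → j < b → h.1 i j + h.1 (a - 1 - i) (b - 1 - j) = c} := by
    rw [← Fintype.card_subtype, ← Nat.card_eq_fintype_card]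
    exact Nat.card_congr ((Equiv.subtypeSubtypeEquivSubtypeInter _ _).symm.trans
      ((planePartitionEquiv a b c).subtypeEquiv fun T => T.2.ppKappa_eq_iff))
  rw [hsum, hcard, card_rotationFixed_eq_card_toggleFixed,
    card_toggleFixed_eq_card_parityMaximal, sum_heightSign]
end
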